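/- Littlewood identity for q-Whittaker polynomials at even modulus: ∑_{μ : μ' even} b_μ(q²) P_μ(x;q²) = ∏_{1 ≤ i < j ≤ n} 1/(x_i x_j ; q²)_∞, the sum being over partitions all of whose columns have even length. -/

import Mathlib

/-- Integer partitions, encoded as weakly decreasing eventually-zero sequences. -/
abbrev YD : Type := {f : ℕ → ℕ // (∀ i j : ℕ, i ≤ j → f j ≤ f i) ∧ ∃ N, f N = 0}

/-- The size of a partition. -/
noncomputable def psize (f : ℕ → ℕ) : ℕ := ∑ᶠ i, f i

/-- `conj f c` is the length of the `(c+1)`-st column of the partition `f`. -/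
noncomputable def conj (f : ℕ → ℕ) (c : ℕ) : ℕ := Nat.card {r : ℕ | c + 1 ≤ f r}

/-- The q-Pochhammer symbol `(p;p)_m`. -/
def qPoch (p : ℂ) (m : ℕ) : ℂ := ∏ j ∈ Finset.range m, (1 - p ^ (j + 1))

/-- The infinite q-Pochhammer symbol `(z;q)_∞ = ∏_{k ≥ 0} (1 - q^k z)`. -/
noncomputable def qPochInf (z q : ℂ) : ℂ := ∏' k : ℕ, (1 - q ^ k * z)

/-! ### Vertically strict tableaux, the combinatorial R-matrix and the intrinsic energy.

A column of a vertically strict tableau is encoded as a `Finset ℕ` of its (distinct)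
entries; a vertically strict tableau is the list of its columns, left to right. -/

/-- The sorted parenthesis word of the pair of columns `x ⊗ y`: letters written in
increasing order, entries of `x` marked `true` ("(" ) and entries of `y` marked
`false` (")"), with the convention that at equal letters the one of `x` comes first. -/
def colPairWord (n : ℕ) (x y : Finset ℕ) : List (ℕ × Bool) :=
  (List.range (n + 1)).flatMap fun l =>
    (if l ∈ x then [(l, true)] else []) ++ (if l ∈ y then [(l, false)] else [])

/-- Match consecutive pairs "(" ")" in the word; return the list of unmatched "("
letters (most recent first) and unmatched ")" letters (in left-to-right order). -/
def scanRS (w : List (ℕ × Bool)) : List ℕ × List ℕ :=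
  w.foldl
    (fun st p =>
      if p.2 then (p.1 :: st.1, st.2)
      else
        match st.1 with
        | [] => (st.1, st.2 ++ [p.1])
        | _ :: t => (t, st.2))
    ([], [])

/-- The local energy `H(x ⊗ y)`: the number of winding pairs, i.e. of pairs matched
cyclically among unmatched parentheses. -/
def Hloc (n : ℕ) (x y : Finset ℕ) : ℕ :=
  min (scanRS (colPairWord n x y)).1.length (scanRS (colPairWord n x y)).2.length

/-- The right output component of the combinatorial R-matrix
`R(x ⊗ y) = ỹ ⊗ x̃`: this returns `x̃` (the column of the same height as `x`),
obtained by flipping the orientation of the parentheses left unmatched after the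
winding matching. -/
def Rright (n : ℕ) (x y : Finset ℕ) : Finset ℕ :=
  let st := (scanRS (colPairWord n x y)).1
  let cl := (scanRS (colPairWord n x y)).2
  let h := min st.length cl.length
  (y \ (cl.drop h).toFinset) ∪ (st.drop h).toFinset

/-- `rowE n x ys = ∑_j H(x^{(j-1)} ⊗ y_j)` where `x` is carried to the right through
the columns `ys` by the combinatorial R-matrix. -/
def rowE (n : ℕ) : Finset ℕ → List (Finset ℕ) → ℕ
  | _, [] => 0
  | x, y :: ys => Hloc n x y + rowE n (Rright n x y) ys

/-- The intrinsic energy `𝓗` of a vertically strict tableau given by its columns. -/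
def intrinsicE (n : ℕ) : List (Finset ℕ) → ℕ
  | [] => 0
  | x :: ys => rowE n x ys + intrinsicE n ys

/-- The number of `a`-cells of a vertically strict tableau. -/
def cnt (L : List (Finset ℕ)) (a : ℕ) : ℕ := (L.map fun s => if a ∈ s then 1 else 0).sum

/-- Vertically strict tableaux of shape `μ` with entries in `{1,…,n}`:
lists of columns, the `(j+1)`-st of which is a subset of `{1,…,n}` of size `μ'_{j+1}`. -/
abbrev VSTt (n : ℕ) (μ : ℕ → ℕ) : Type :=
  {L : List (Finset ℕ) // L.length = μ 0 ∧
    ∀ j : Fin L.length, (L.get j).card = conj μ (j : ℕ) ∧ ∀ a ∈ L.get j, 1 ≤ a ∧ a ≤ n}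

/-- The q-Whittaker polynomial
`P_μ(x₁,…,x_n; q) = ∑_{V ∈ VST(μ)} q^{𝓗(V)} x^V`. -/
noncomputable def qWhit (n : ℕ) (x : ℕ → ℂ) (q : ℂ) (μ : ℕ → ℕ) : ℂ :=
  ∑' V : VSTt n μ, q ^ intrinsicE n V.val * ∏ a ∈ Finset.Icc 1 n, x a ^ cnt V.val a

/-- `b_μ(q) = ∏_{i ≥ 1} 1/(q;q)_{μ_i - μ_{i+1}}`. -/
noncomputable def bmu (q : ℂ) (μ : ℕ → ℕ) : ℂ :=
  ∏ᶠ i : ℕ, (qPoch q (μ i - μ (i + 1)))⁻¹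

namespace QWhittaker

/-! ### The queue description of the combinatorial R-matrix -/

/-- Number of entries of `y` among the `k` largest letters `n, n - 1, …` which are still
waiting for a partner in `x`, when `v` of them are waiting at the start. -/
def demand (n : ℕ) (x y : Finset ℕ) (v : ℕ) : ℕ → ℕ
  | 0 => v
  | k + 1 => demand n x y v k + (if n - k ∈ y then 1 else 0) - (if n - k ∈ x then 1 else 0)

/-- The number of winding pairs of `x ⊗ y`, when `x` has at least as many entries as `y`. -/
def winding (n : ℕ) (x y : Finset ℕ) : ℕ := demand n x y 0 n

/-- The column `x` carried through `y`, when `x` has at least as many entries as `y`. -/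
def carry (n : ℕ) (x y : Finset ℕ) : Finset ℕ :=
  y ∪ x.filter fun l => demand n x y (winding n x y) (n - l) = 0

theorem mem_carry {n : ℕ} {x y : Finset ℕ} {l : ℕ} :
    l ∈ carry n x y ↔ l ∈ y ∨ l ∈ x ∧ demand n x y (winding n x y) (n - l) = 0 := by
  simp [carry]

/-- One step of the parenthesis matching. -/
def scanStep (st : List ℕ × List ℕ) (p : ℕ × Bool) : List ℕ × List ℕ :=
  if p.2 then (p.1 :: st.1, st.2)
  else
    match st.1 with
    | [] => (st.1, st.2 ++ [p.1])
    | _ :: t => (t, st.2)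

theorem scanRS_eq_foldl (w : List (ℕ × Bool)) : scanRS w = w.foldl scanStep ([], []) := rfl

theorem foldl_scanStep (w : List (ℕ × Bool)) (S C : List ℕ) :
    w.foldl scanStep (S, C) =
      ((scanRS w).1 ++ S.drop (scanRS w).2.length, C ++ (scanRS w).2.drop S.length) := by
  induction w using List.reverseRecOn with
  | nil => simp [scanRS]
  | append_singleton w p ih =>
    have h : scanRS (w ++ [p]) = scanStep (scanRS w) p := by
      simp [scanRS_eq_foldl, List.foldl_append]
    rw [List.foldl_append, List.foldl_cons, List.foldl_nil, ih, h]
    obtain ⟨l, b⟩ := p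
    rcases hs : scanRS w with ⟨st, cl⟩
    cases b
    · cases st with
      | nil =>
        simp only [scanStep, List.nil_append, Bool.false_eq_true, if_false]
        rcases hd : S.drop cl.length with _ | ⟨s, t⟩
        · have : S.length ≤ cl.length := by simpa using hd
          simp [List.drop_append_of_le_length this]
          omega
        · have hlt : cl.length < S.length := by
            by_contra hc
            rw [List.drop_eq_nil_of_le (by omega)] at hd
            simp at hd
          have h1 : S.drop (cl.length + 1) = t := by
            rw [← List.drop_drop, hd]; rfl
          simp [h1]
          rw [List.drop_eq_nil_of_le (by simpa using hlt.le),
            List.drop_eq_nil_of_le (by simpa using hlt)]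
      | cons s t => simp [scanStep]
    · simp [scanStep]

theorem scanRS_cons_true (l : ℕ) (w : List (ℕ × Bool)) :
    scanRS ((l, true) :: w) =
      if (scanRS w).2 = [] then ((scanRS w).1 ++ [l], [])
      else ((scanRS w).1, (scanRS w).2.tail) := by
  rw [scanRS_eq_foldl, List.foldl_cons]
  have : scanStep ([], []) (l, true) = ([l], []) := rfl
  rw [this, foldl_scanStep]
  rcases (scanRS w).2 with _ | ⟨c, t⟩ <;> simp

theorem scanRS_cons_false (l : ℕ) (w : List (ℕ × Bool)) :
    scanRS ((l, false) :: w) = ((scanRS w).1, l :: (scanRS w).2) := by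
  rw [scanRS_eq_foldl, List.foldl_cons]
  have : scanStep ([], []) (l, false) = ([], [l]) := rfl
  rw [this, foldl_scanStep]
  simp

/-- The part of `colPairWord n x y` made of the `k` largest letters. -/
def topWord (n : ℕ) (x y : Finset ℕ) (k : ℕ) : List (ℕ × Bool) :=
  (List.range' (n + 1 - k) k).flatMap fun l =>
    (if l ∈ x then [(l, true)] else []) ++ (if l ∈ y then [(l, false)] else [])

theorem topWord_succ {n : ℕ} (x y : Finset ℕ) {k : ℕ} (hk : k ≤ n) :
    topWord n x y (k + 1) = ((if n - k ∈ x then [(n - k, true)] else []) ++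
      (if n - k ∈ y then [(n - k, false)] else [])) ++ topWord n x y k := by
  have h : n + 1 - (k + 1) = n - k := by omega
  have h' : n - k + 1 = n + 1 - k := by omega
  rw [topWord, h, List.range'_succ, List.flatMap_cons, h']
  rfl

theorem card_filter_top_succ {n : ℕ} (x : Finset ℕ) {k : ℕ} (hk : k ≤ n) :
    (x.filter fun l => n < l + (k + 1)).card =
      (x.filter fun l => n < l + k).card + if n - k ∈ x then 1 else 0 := by
  split_ifs with h
  · have : (x.filter fun l => n < l + (k + 1)) = insert (n - k) (x.filter fun l => n < l + k) := by
      ext l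
      simp only [Finset.mem_filter, Finset.mem_insert]
      constructor
      · rintro ⟨h1, h2⟩
        by_cases hl : l = n - k
        · exact Or.inl hl
        · exact Or.inr ⟨h1, by omega⟩
      · rintro (rfl | ⟨h1, h2⟩)
        · exact ⟨h, by omega⟩
        · exact ⟨h1, by omega⟩
    rw [this, Finset.card_insert_of_notMem]
    simp only [Finset.mem_filter, not_and]
    omega
  · congr 1
    ext l
    simp only [Finset.mem_filter]
    constructor
    · rintro ⟨h1, h2⟩
      refine ⟨h1, ?_⟩
      have : l ≠ n - k := fun e => h (e ▸ h1)
      omega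
    · rintro ⟨h1, h2⟩
      exact ⟨h1, by omega⟩

theorem scanRS_topWord {n : ℕ} {x y : Finset ℕ} (hx : ∀ l ∈ x, l ≤ n) (hy : ∀ l ∈ y, l ≤ n)
    (h : ℕ) {k : ℕ} (hk : k ≤ n + 1) :
    (scanRS (topWord n x y k)).2.length = demand n x y 0 k ∧
    demand n x y h k =
      (scanRS (topWord n x y k)).2.length + (h - (scanRS (topWord n x y k)).1.length) ∧
    (scanRS (topWord n x y k)).1.length + (y.filter fun l => n < l + k).card =
      (scanRS (topWord n x y k)).2.length + (x.filter fun l => n < l + k).card ∧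
    ∀ l, l ∈ (scanRS (topWord n x y k)).1.drop h ↔
      (n < l + k ∧ l ≤ n) ∧ l ∈ x ∧ l ∉ y ∧ demand n x y h (n - l) = 0 := by
  induction k with
  | zero =>
    refine ⟨rfl, by simp [topWord, scanRS, demand], ?_, fun l => ?_⟩
    · rw [Finset.filter_false_of_mem (by simpa using hy),
        Finset.filter_false_of_mem (by simpa using hx)]
      rfl
    · simp [topWord, scanRS]
  | succ k ih =>
    obtain ⟨h1, h2, h3, h4⟩ := ih (by omega)
    have hkn : k ≤ n := by omega
    have key : ∀ l, (n < l + (k + 1) ∧ l ≤ n) ↔ (n < l + k ∧ l ≤ n) ∨ l = n - k := by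
      intro l; omega
    have hnk : n - (n - k) = k := by omega
    have hnot : ¬ (n < (n - k) + k ∧ n - k ≤ n) := by omega
    simp only [card_filter_top_succ _ hkn, demand, key, or_and_right]
    rw [topWord_succ _ _ hkn]
    by_cases hX : n - k ∈ x <;> by_cases hY : n - k ∈ y
    · simp only [hX, hY, if_true, List.cons_append, List.nil_append, scanRS_cons_true,
        scanRS_cons_false]
      refine ⟨by simpa using h1, by simp; omega, by simp; omega, fun l => ?_⟩
      simp only [reduceCtorEq, if_false]
      rw [h4]
      constructor
      · exact Or.inl
      · rintro (h | ⟨rfl, -, h, -⟩)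
        · exact h
        · exact absurd hY h
    · simp only [hX, hY, if_true, if_false, List.singleton_append, List.append_nil,
        scanRS_cons_true]
      split_ifs with hc
      · simp only [hc, List.length_nil] at h1 h2 h3 ⊢
        refine ⟨by omega, by simp; omega, by simp; omega, fun l => ?_⟩
        rw [List.drop_append, List.mem_append, h4]
        refine or_congr Iff.rfl ?_
        constructor
        · intro hl
          have hlt : h - (scanRS (topWord n x y k)).1.length = 0 := by
            by_contra hne
            rw [List.drop_eq_nil_of_le (by simp; omega)] at hl
            simp at hl
          rw [hlt] at hl
          have : l = n - k := by simpa using hl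
          subst this
          exact ⟨rfl, hX, hY, by rw [hnk]; omega⟩
        · rintro ⟨rfl, -, -, h0⟩
          rw [hnk] at h0
          have hlt : h - (scanRS (topWord n x y k)).1.length = 0 := by omega
          rw [hlt]
          simp
      · have hpos : 0 < (scanRS (topWord n x y k)).2.length := List.length_pos_iff.mpr hc
        simp only [List.length_tail]
        refine ⟨by omega, by omega, by omega, fun l => ?_⟩
        rw [h4]
        constructor
        · exact Or.inl
        · rintro (h | ⟨rfl, -, -, h0⟩)
          · exact h
          · rw [hnk] at h0
            omega
    · simp only [hX, hY, if_true, if_false, List.nil_append, List.singleton_append,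
        scanRS_cons_false, List.length_cons]
      refine ⟨by omega, by omega, by omega, fun l => ?_⟩
      rw [h4]
      constructor
      · exact Or.inl
      · rintro (h | ⟨rfl, h, -⟩)
        · exact h
        · exact absurd h hX
    · simp only [hX, hY, if_false, List.nil_append]
      refine ⟨by omega, by omega, by omega, fun l => ?_⟩
      rw [h4]
      constructor
      · exact Or.inl
      · rintro (h | ⟨rfl, h, -⟩)
        · exact h
        · exact absurd h hX

theorem colPairWord_eq_topWord (n : ℕ) (x y : Finset ℕ) :
    colPairWord n x y = topWord n x y (n + 1) := by
  rw [colPairWord, topWord, Nat.sub_self, List.range_eq_range']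

theorem demand_succ_top {n : ℕ} {x y : Finset ℕ} (hx : x ⊆ Finset.Icc 1 n)
    (hy : y ⊆ Finset.Icc 1 n) (v : ℕ) : demand n x y v (n + 1) = demand n x y v n := by
  have h0 : ∀ z : Finset ℕ, z ⊆ Finset.Icc 1 n → 0 ∉ z := fun z hz h => by
    simpa using hz h
  simp [demand, h0 x hx, h0 y hy]

theorem filter_top_eq_self {n : ℕ} {x : Finset ℕ} : (x.filter fun l => n < l + (n + 1)) = x :=
  Finset.filter_true_of_mem fun l _ => by omega

section Matching

variable {n : ℕ} {x y : Finset ℕ}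

theorem scanRS_colPairWord (hx : x ⊆ Finset.Icc 1 n) (hy : y ⊆ Finset.Icc 1 n)
    (hxy : y.card ≤ x.card) :
    (scanRS (colPairWord n x y)).2.length = winding n x y ∧
    (scanRS (colPairWord n x y)).2.length ≤ (scanRS (colPairWord n x y)).1.length ∧
    ∀ l, l ∈ (scanRS (colPairWord n x y)).1.drop (winding n x y) ↔
      l ∈ x ∧ l ∉ y ∧ demand n x y (winding n x y) (n - l) = 0 := by
  have hx' : ∀ l ∈ x, l ≤ n := fun l hl => (Finset.mem_Icc.mp (hx hl)).2
  have hy' : ∀ l ∈ y, l ≤ n := fun l hl => (Finset.mem_Icc.mp (hy hl)).2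
  obtain ⟨h1, -, h3, h4⟩ := scanRS_topWord hx' hy' (winding n x y) le_rfl
  rw [demand_succ_top hx hy] at h1
  rw [filter_top_eq_self, filter_top_eq_self] at h3
  rw [colPairWord_eq_topWord]
  refine ⟨h1, by omega, fun l => (h4 l).trans ?_⟩
  refine and_iff_right_of_imp fun h => ⟨by omega, hx' l h.1⟩

theorem Hloc_eq_winding (hx : x ⊆ Finset.Icc 1 n) (hy : y ⊆ Finset.Icc 1 n)
    (hxy : y.card ≤ x.card) : Hloc n x y = winding n x y := by
  obtain ⟨h1, h2, -⟩ := scanRS_colPairWord hx hy hxy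
  rw [Hloc, min_eq_right h2, h1]

theorem Rright_eq_carry (hx : x ⊆ Finset.Icc 1 n) (hy : y ⊆ Finset.Icc 1 n)
    (hxy : y.card ≤ x.card) : Rright n x y = carry n x y := by
  obtain ⟨h1, h2, h3⟩ := scanRS_colPairWord hx hy hxy
  ext l
  rw [mem_carry]
  simp only [Rright]
  rw [min_eq_right h2, List.drop_length, h1]
  simp only [List.toFinset_nil, Finset.sdiff_empty, Finset.mem_union, List.mem_toFinset, h3]
  tauto

theorem demand_eq_max (hx : ∀ l ∈ x, l ≤ n) (hy : ∀ l ∈ y, l ≤ n) (v : ℕ) {k : ℕ}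
    (hk : k ≤ n + 1) :
    demand n x y v k = max (demand n x y 0 k)
      (v + (y.filter fun l => n < l + k).card - (x.filter fun l => n < l + k).card) := by
  induction k with
  | zero =>
    rw [Finset.filter_false_of_mem (by simpa using hy),
      Finset.filter_false_of_mem (by simpa using hx)]
    simp [demand]
  | succ k ih =>
    have := ih (by omega)
    rw [card_filter_top_succ _ (by omega), card_filter_top_succ _ (by omega), demand, demand]
    omega

/-- The number of pairs waiting after one turn is stationary. -/
theorem demand_winding (hx : x ⊆ Finset.Icc 1 n) (hy : y ⊆ Finset.Icc 1 n)
    (hxy : y.card ≤ x.card) : demand n x y (winding n x y) n = winding n x y := by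
  have hx' : ∀ l ∈ x, l ≤ n := fun l hl => (Finset.mem_Icc.mp (hx hl)).2
  have hy' : ∀ l ∈ y, l ≤ n := fun l hl => (Finset.mem_Icc.mp (hy hl)).2
  have := demand_eq_max hx' hy' (winding n x y) le_rfl
  rw [demand_succ_top hx hy, demand_succ_top hx hy, filter_top_eq_self, filter_top_eq_self] at this
  rw [this, ← winding]
  omega

theorem demand_mono (n : ℕ) (x y : Finset ℕ) {u v : ℕ} (h : u ≤ v) (k : ℕ) :
    demand n x y u k ≤ demand n x y v k := by
  induction k with
  | zero => exact h
  | succ k ih => simp only [demand]; omega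

theorem carry_subset (hx : x ⊆ Finset.Icc 1 n) (hy : y ⊆ Finset.Icc 1 n) :
    carry n x y ⊆ Finset.Icc 1 n :=
  Finset.union_subset hy ((Finset.filter_subset _ _).trans hx)

theorem card_carry (hx : x ⊆ Finset.Icc 1 n) (hy : y ⊆ Finset.Icc 1 n)
    (hxy : y.card ≤ x.card) : (carry n x y).card = x.card := by
  have hx' : ∀ l ∈ x, l ≤ n := fun l hl => (Finset.mem_Icc.mp (hx hl)).2
  have hc' : ∀ l ∈ carry n x y, l ≤ n :=
    fun l hl => (Finset.mem_Icc.mp (carry_subset hx hy hl)).2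
  have key : ∀ k ≤ n + 1, ((carry n x y).filter fun l => n < l + k).card + winding n x y =
      (x.filter fun l => n < l + k).card + demand n x y (winding n x y) k := by
    intro k
    induction k with
    | zero =>
      intro _
      rw [Finset.filter_false_of_mem (by simpa using hc'),
        Finset.filter_false_of_mem (by simpa using hx')]
      rfl
    | succ k ih =>
      intro hk
      have := ih (by omega)
      rw [card_filter_top_succ _ (by omega), card_filter_top_succ _ (by omega), demand]
      have hnk : n - (n - k) = k := by omega
      have hm := @mem_carry n x y (n - k)
      rw [hnk] at hm
      by_cases h1 : n - k ∈ x <;> by_cases h2 : n - k ∈ y <;>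
        by_cases h3 : demand n x y (winding n x y) k = 0 <;>
        simp only [h1, h2, h3, or_true, true_and, false_and, and_self, or_self, iff_true,
          iff_false, if_true, if_false, or_false] at hm ⊢ <;>
        simp only [hm, if_true, if_false] <;> omega
  have := key (n + 1) le_rfl
  rw [demand_succ_top hx hy, demand_winding hx hy hxy, filter_top_eq_self,
    filter_top_eq_self] at this
  omega

end Matching

/-! ### Rotation of the letters -/

/-- The cyclic shift `l ↦ l + 1` of the letters `1, …, n`. -/
def rotate (n : ℕ) (x : Finset ℕ) : Finset ℕ := x.image fun l => if l = n then 1 else l + 1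

section Rotation

variable {n : ℕ} {x y : Finset ℕ}

theorem rotate_subset (hx : x ⊆ Finset.Icc 1 n) : rotate n x ⊆ Finset.Icc 1 n := by
  intro l hl
  obtain ⟨m, hm, rfl⟩ := Finset.mem_image.mp hl
  have := Finset.mem_Icc.mp (hx hm)
  rw [Finset.mem_Icc]
  split_ifs <;> omega

theorem succ_mem_rotate {l : ℕ} (h1 : 1 ≤ l) (h2 : l < n) : l + 1 ∈ rotate n x ↔ l ∈ x := by
  rw [rotate, Finset.mem_image]
  constructor
  · rintro ⟨m, hm, h⟩
    split_ifs at h with hmn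
    · omega
    · have : m = l := by omega
      exact this ▸ hm
  · intro h
    exact ⟨l, h, by simp [h2.ne]⟩

theorem one_mem_rotate (hx : x ⊆ Finset.Icc 1 n) : 1 ∈ rotate n x ↔ n ∈ x := by
  rw [rotate, Finset.mem_image]
  constructor
  · rintro ⟨m, hm, h⟩
    have := Finset.mem_Icc.mp (hx hm)
    split_ifs at h with hmn
    · exact hmn ▸ hm
    · omega
  · intro h
    exact ⟨n, h, by simp⟩

theorem injOn_rotate :
    Set.InjOn (fun l => if l = n then 1 else l + 1) (Finset.Icc 1 n : Set ℕ) := by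
  intro a ha b hb h
  simp only [Finset.coe_Icc, Set.mem_Icc] at ha hb
  simp only at h
  split_ifs at h <;> omega

theorem card_rotate (hx : x ⊆ Finset.Icc 1 n) : (rotate n x).card = x.card :=
  Finset.card_image_of_injOn (injOn_rotate.mono (by exact_mod_cast hx))

theorem demand_rotate (v : ℕ) {k : ℕ} (hk : k + 1 ≤ n) :
    demand n (rotate n x) (rotate n y) (demand n x y v 1) k = demand n x y v (k + 1) := by
  induction k with
  | zero => rfl
  | succ k ih =>
    have h : n - k = n - (k + 1) + 1 := by omega
    have := ih (by omega)
    simp only [demand] at this ⊢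
    simp only [this, h, succ_mem_rotate (show 1 ≤ n - (k + 1) by omega)
      (show n - (k + 1) < n by omega)]

theorem winding_rotate_eq_demand (hn : 1 ≤ n) (hx : x ⊆ Finset.Icc 1 n) (hy : y ⊆ Finset.Icc 1 n)
    (hxy : y.card ≤ x.card) :
    winding n (rotate n x) (rotate n y) = demand n x y (winding n x y) 1 := by
  obtain ⟨m, rfl⟩ : ∃ m, n = m + 1 := ⟨n - 1, by omega⟩
  have step : ∀ v, demand (m + 1) (rotate (m + 1) x) (rotate (m + 1) y)
      (demand (m + 1) x y v 1) (m + 1) =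
        demand (m + 1) x y (demand (m + 1) x y v (m + 1)) 1 := by
    intro v
    have h1 : (m + 1 - m) = 1 := by omega
    rw [demand, demand_rotate v le_rfl]
    simp only [h1, one_mem_rotate hx, one_mem_rotate hy]
    rfl
  apply le_antisymm
  · have := step (winding (m + 1) x y)
    rw [demand_winding hx hy hxy] at this
    rw [← this]
    exact demand_mono _ _ _ (Nat.zero_le _) _
  · have hs := demand_winding (rotate_subset hx) (rotate_subset hy)
      (by rwa [card_rotate hx, card_rotate hy])
    set H := winding (m + 1) (rotate (m + 1) x) (rotate (m + 1) y) with hH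
    set u := demand (m + 1) (rotate (m + 1) x) (rotate (m + 1) y) H m with hu
    have h1 : (m + 1 - m) = 1 := by omega
    have hHu : H = demand (m + 1) x y u 1 := by
      conv_lhs => rw [← hs]
      simp only [demand, h1, one_mem_rotate hx, one_mem_rotate hy]
      rfl
    have hfix : demand (m + 1) x y u (m + 1) = u := by
      rw [← demand_rotate u le_rfl, ← hHu]
    have : winding (m + 1) x y ≤ u := by
      rw [← hfix]
      exact demand_mono _ _ _ (Nat.zero_le _) _
    rw [hHu]
    exact demand_mono _ _ _ this _

theorem winding_rotate (hn : 1 ≤ n) (hx : x ⊆ Finset.Icc 1 n) (hy : y ⊆ Finset.Icc 1 n)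
    (hxy : y.card ≤ x.card) :
    winding n (rotate n x) (rotate n y) + (if n ∈ x then 1 else 0) =
      winding n x y + if n ∈ carry n x y then 1 else 0 := by
  have hm := @mem_carry n x y n
  rw [Nat.sub_self] at hm
  rw [winding_rotate_eq_demand hn hx hy hxy]
  simp only [demand, Nat.sub_zero] at hm ⊢
  by_cases h1 : n ∈ x <;> by_cases h2 : n ∈ y <;> by_cases h3 : n ∈ carry n x y <;>
    simp only [h1, h2, h3, true_and, false_and, true_or, false_or, or_self, true_iff, false_iff,
      if_true, if_false, iff_self, not_true] at hm ⊢ <;> omega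

theorem carry_rotate (hn : 1 ≤ n) (hx : x ⊆ Finset.Icc 1 n) (hy : y ⊆ Finset.Icc 1 n)
    (hxy : y.card ≤ x.card) :
    carry n (rotate n x) (rotate n y) = rotate n (carry n x y) := by
  ext l
  by_cases hl : l ∈ Finset.Icc 1 n
  · have hl' := Finset.mem_Icc.mp hl
    rcases Nat.lt_or_ge 1 l with h | h
    · obtain ⟨m, rfl⟩ : ∃ m, l = m + 1 := ⟨l - 1, by omega⟩
      rw [mem_carry, succ_mem_rotate (by omega) (by omega), succ_mem_rotate (by omega) (by omega),
        succ_mem_rotate (by omega) (by omega), mem_carry, winding_rotate_eq_demand hn hx hy hxy,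
        demand_rotate _ (by omega)]
      have : n - (m + 1) + 1 = n - m := by omega
      rw [this]
    · obtain rfl : l = 1 := by omega
      rw [mem_carry, one_mem_rotate hx, one_mem_rotate hy, one_mem_rotate (carry_subset hx hy),
        mem_carry, winding_rotate_eq_demand hn hx hy hxy, demand_rotate _ (by omega)]
      have : n - 1 + 1 = n := by omega
      rw [this, demand_winding hx hy hxy, Nat.sub_self]
      rfl
  · exact iff_of_false (fun h => hl (carry_subset (rotate_subset hx) (rotate_subset hy) h))
      (fun h => hl (rotate_subset (carry_subset hx hy) h))

end Rotation

/-! ### Two adjacent letters -/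

/-- Replace the letter `a + 1` by `a` where this is possible. -/
def sortAt (a : ℕ) (D : Finset ℕ) : Finset ℕ :=
  if a + 1 ∈ D ∧ a ∉ D then insert a (D.erase (a + 1)) else D

theorem mem_sortAt_self {a : ℕ} {D : Finset ℕ} : a ∈ sortAt a D ↔ a ∈ D ∨ a + 1 ∈ D := by
  by_cases h1 : a ∈ D <;> by_cases h2 : a + 1 ∈ D <;> simp [sortAt, h1, h2]

theorem mem_sortAt_succ {a : ℕ} {D : Finset ℕ} : a + 1 ∈ sortAt a D ↔ a ∈ D ∧ a + 1 ∈ D := by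
  by_cases h1 : a ∈ D <;> by_cases h2 : a + 1 ∈ D <;> simp [sortAt, h1, h2]

theorem mem_sortAt_of_ne {a l : ℕ} {D : Finset ℕ} (h : l ≠ a) (h' : l ≠ a + 1) :
    l ∈ sortAt a D ↔ l ∈ D := by
  unfold sortAt
  split_ifs <;> simp [h, h']

theorem sortAt_of_mem {a : ℕ} {D : Finset ℕ} (h : a ∈ D) : sortAt a D = D := by
  simp [sortAt, h]

/-- The effect of the letter `l` on the number of waiting entries. -/
def demandStep (x y : Finset ℕ) (l v : ℕ) : ℕ :=
  v + (if l ∈ y then 1 else 0) - (if l ∈ x then 1 else 0)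

section Block

variable {n a : ℕ} {x y x' y' : Finset ℕ}

theorem demand_eq_of_block (ha : 1 ≤ a) (hb : a + 1 ≤ n)
    (hx : ∀ l, l ≠ a → l ≠ a + 1 → (l ∈ x ↔ l ∈ x'))
    (hy : ∀ l, l ≠ a → l ≠ a + 1 → (l ∈ y ↔ l ∈ y'))
    (h : ∀ v, demandStep x y a (demandStep x y (a + 1) v) =
      demandStep x' y' a (demandStep x' y' (a + 1) v)) (v : ℕ) {k : ℕ} (hk : k ≠ n - a) :
    demand n x y v k = demand n x' y' v k := by
  induction k using Nat.strong_induction_on with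
  | _ k ih =>
    rcases k with _ | k
    · rfl
    · by_cases hka : k = n - a
      · obtain ⟨j, rfl⟩ : ∃ j, k = j + 1 := ⟨k - 1, by omega⟩
        have h1 : n - (j + 1) = a := by omega
        have h2 : n - j = a + 1 := by omega
        have := h (demand n x y v j)
        conv_rhs at this => rw [ih j (by omega) (by omega)]
        simpa only [demand, h1, h2, demandStep] using this
      · simp only [demand, ih k (by omega) hka, hx (n - k) (by omega) (by omega),
          hy (n - k) (by omega) (by omega)]

theorem winding_eq_of_block (ha : 1 ≤ a) (hb : a + 1 ≤ n)
    (hx : ∀ l, l ≠ a → l ≠ a + 1 → (l ∈ x ↔ l ∈ x'))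
    (hy : ∀ l, l ≠ a → l ≠ a + 1 → (l ∈ y ↔ l ∈ y'))
    (h : ∀ v, demandStep x y a (demandStep x y (a + 1) v) =
      demandStep x' y' a (demandStep x' y' (a + 1) v)) :
    winding n x y = winding n x' y' :=
  demand_eq_of_block ha hb hx hy h 0 (by omega)

theorem mem_carry_of_block (ha : 1 ≤ a) (hb : a + 1 ≤ n)
    (hx : ∀ l, l ≠ a → l ≠ a + 1 → (l ∈ x ↔ l ∈ x'))
    (hy : ∀ l, l ≠ a → l ≠ a + 1 → (l ∈ y ↔ l ∈ y'))
    (h : ∀ v, demandStep x y a (demandStep x y (a + 1) v) =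
      demandStep x' y' a (demandStep x' y' (a + 1) v)) :
    (∀ l, l ≠ a → l ≠ a + 1 → (l ∈ carry n x y ↔ l ∈ carry n x' y')) ∧
    ∃ d, (a + 1 ∈ carry n x y ↔ a + 1 ∈ y ∨ a + 1 ∈ x ∧ d = 0) ∧
      (a ∈ carry n x y ↔ a ∈ y ∨ a ∈ x ∧ demandStep x y (a + 1) d = 0) ∧
      (a + 1 ∈ carry n x' y' ↔ a + 1 ∈ y' ∨ a + 1 ∈ x' ∧ d = 0) ∧
      (a ∈ carry n x' y' ↔ a ∈ y' ∨ a ∈ x' ∧ demandStep x' y' (a + 1) d = 0) := by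
  have hw := winding_eq_of_block ha hb hx hy h
  refine ⟨fun l h1 h2 => ?_, demand n x y (winding n x y) (n - (a + 1)), ?_⟩
  · rw [mem_carry, mem_carry, hx l h1 h2, hy l h1 h2, hw,
      demand_eq_of_block ha hb hx hy h _ (by omega : n - l ≠ n - a)]
  · have h1 : n - a = n - (a + 1) + 1 := by omega
    have h2 : n - (n - (a + 1)) = a + 1 := by omega
    have h3 := demand_eq_of_block ha hb hx hy h (winding n x y)
      (by omega : n - (a + 1) ≠ n - a)
    refine ⟨mem_carry, ?_, ?_, ?_⟩
    · rw [mem_carry, h1, demand, h2, demandStep]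
    · rw [mem_carry, h3, hw]
    · rw [mem_carry, h1, demand, h2, demandStep, h3, hw]

theorem winding_sortAt_of_not_mem (ha : 1 ≤ a) (hb : a + 1 ≤ n) (h1 : a ∉ y) (h2 : a + 1 ∉ y) :
    winding n (sortAt a x) y = winding n x y ∧
      carry n (sortAt a x) y = sortAt a (carry n x y) := by
  have hx : ∀ l, l ≠ a → l ≠ a + 1 → (l ∈ sortAt a x ↔ l ∈ x) := fun l => mem_sortAt_of_ne
  have h : ∀ v, demandStep (sortAt a x) y a (demandStep (sortAt a x) y (a + 1) v) =
      demandStep x y a (demandStep x y (a + 1) v) := by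
    intro v
    simp only [demandStep, mem_sortAt_self, mem_sortAt_succ, h1, h2, if_false]
    by_cases h3 : a ∈ x <;> by_cases h4 : a + 1 ∈ x <;> simp [h3, h4]
  refine ⟨winding_eq_of_block ha hb hx (fun _ _ _ => Iff.rfl) h, ?_⟩
  obtain ⟨hl, d, e1, e2, e3, e4⟩ := mem_carry_of_block ha hb hx (fun _ _ _ => Iff.rfl) h
  ext l
  by_cases la : l = a
  · subst la
    rw [mem_sortAt_self, e2, e3, e4, mem_sortAt_self]
    simp only [demandStep, mem_sortAt_succ]
    by_cases h3 : l ∈ x <;> by_cases h4 : l + 1 ∈ x <;> simp [h1, h2, h3, h4]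
    omega
  by_cases lb : l = a + 1
  · subst lb
    rw [mem_sortAt_succ, e1, e3, e4, mem_sortAt_succ, demandStep]
    by_cases h3 : a ∈ x <;> by_cases h4 : a + 1 ∈ x <;> simp [h1, h2, h3, h4]
    omega
  · rw [mem_sortAt_of_ne la lb, hl l la lb]

theorem winding_sortAt_of_mem (ha : 1 ≤ a) (hb : a + 1 ≤ n) (h1 : a ∈ y) (h2 : a + 1 ∈ y) :
    winding n (sortAt a x) y = winding n x y ∧
      carry n (sortAt a x) y = sortAt a (carry n x y) := by
  have hx : ∀ l, l ≠ a → l ≠ a + 1 → (l ∈ sortAt a x ↔ l ∈ x) := fun l => mem_sortAt_of_ne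
  have h : ∀ v, demandStep (sortAt a x) y a (demandStep (sortAt a x) y (a + 1) v) =
      demandStep x y a (demandStep x y (a + 1) v) := by
    intro v
    simp only [demandStep, mem_sortAt_self, mem_sortAt_succ, h1, h2, if_true]
    by_cases h3 : a ∈ x <;> by_cases h4 : a + 1 ∈ x <;> simp [h3, h4]
  refine ⟨winding_eq_of_block ha hb hx (fun _ _ _ => Iff.rfl) h, ?_⟩
  obtain ⟨hl, d, e1, e2, e3, e4⟩ := mem_carry_of_block ha hb hx (fun _ _ _ => Iff.rfl) h
  ext l
  by_cases la : l = a
  · subst la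
    rw [mem_sortAt_self, e2, e3, e4]
    simp [h1]
  by_cases lb : l = a + 1
  · subst lb
    rw [mem_sortAt_succ, e1, e3, e4]
    simp [h1, h2]
  · rw [mem_sortAt_of_ne la lb, hl l la lb]

theorem winding_sortAt_insert_self (ha : 1 ≤ a) (hb : a + 1 ≤ n) (h1 : a ∉ y) (h2 : a + 1 ∉ y) :
    winding n (sortAt a x) (insert a y) = winding n x (insert (a + 1) y) ∧
      carry n (sortAt a x) (insert a y) = sortAt a (carry n x (insert (a + 1) y)) := by
  have hx : ∀ l, l ≠ a → l ≠ a + 1 → (l ∈ sortAt a x ↔ l ∈ x) := fun l => mem_sortAt_of_ne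
  have hy : ∀ l, l ≠ a → l ≠ a + 1 → (l ∈ insert a y ↔ l ∈ insert (a + 1) y) := by
    intro l h h'
    simp [h, h']
  have h : ∀ v, demandStep (sortAt a x) (insert a y) a
      (demandStep (sortAt a x) (insert a y) (a + 1) v) =
      demandStep x (insert (a + 1) y) a (demandStep x (insert (a + 1) y) (a + 1) v) := by
    intro v
    simp only [demandStep, mem_sortAt_self, mem_sortAt_succ, Finset.mem_insert]
    by_cases h3 : a ∈ x <;> by_cases h4 : a + 1 ∈ x <;> simp [h1, h2, h3, h4]
  refine ⟨winding_eq_of_block ha hb hx hy h, ?_⟩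
  obtain ⟨hl, d, e1, e2, e3, e4⟩ := mem_carry_of_block ha hb hx hy h
  ext l
  by_cases la : l = a
  · subst la
    rw [mem_sortAt_self, e2, e3, e4]
    simp
  by_cases lb : l = a + 1
  · subst lb
    rw [mem_sortAt_succ, e1, e3, e4, mem_sortAt_succ, demandStep]
    by_cases h3 : a ∈ x <;> by_cases h4 : a + 1 ∈ x <;> simp [h1, h2, h3, h4]
  · rw [mem_sortAt_of_ne la lb, hl l la lb]

theorem winding_sortAt_insert_succ (ha : 1 ≤ a) (hb : a + 1 ≤ n) (h1 : a ∉ y) (h2 : a + 1 ∉ y) :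
    winding n (sortAt a x) (insert (a + 1) y) = winding n x (insert (a + 1) y) ∧
      carry n (sortAt a x) (insert (a + 1) y) = carry n x (insert (a + 1) y) := by
  have hx : ∀ l, l ≠ a → l ≠ a + 1 → (l ∈ sortAt a x ↔ l ∈ x) := fun l => mem_sortAt_of_ne
  have h : ∀ v, demandStep (sortAt a x) (insert (a + 1) y) a
      (demandStep (sortAt a x) (insert (a + 1) y) (a + 1) v) =
      demandStep x (insert (a + 1) y) a (demandStep x (insert (a + 1) y) (a + 1) v) := by
    intro v
    simp only [demandStep, mem_sortAt_self, mem_sortAt_succ, Finset.mem_insert]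
    by_cases h3 : a ∈ x <;> by_cases h4 : a + 1 ∈ x <;> simp [h1, h2, h3, h4]
  refine ⟨winding_eq_of_block ha hb hx (fun _ _ _ => Iff.rfl) h, ?_⟩
  obtain ⟨hl, d, e1, e2, e3, e4⟩ := mem_carry_of_block ha hb hx (fun _ _ _ => Iff.rfl) h
  ext l
  by_cases la : l = a
  · subst la
    rw [e2, e4, mem_sortAt_self]
    simp only [demandStep, mem_sortAt_succ]
    by_cases h3 : l ∈ x <;> by_cases h4 : l + 1 ∈ x <;> simp [h1, h2, h3, h4]
  by_cases lb : l = a + 1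
  · subst lb
    rw [e1, e3]
    simp
  · exact hl l la lb

end Block

/-! ### Transfer sums -/

section TransferSum

variable {A : Type*} [CommRing A]

/-- The weight `w` after the column `c` has been appended on the right. -/
def appendWeight (n : ℕ) (q : A) (c : Finset ℕ) (w : List (Finset ℕ) → A)
    (Ds : List (Finset ℕ)) : A :=
  q ^ (Ds.map fun D => winding n D c).sum * w (Ds.map (fun D => carry n D c) ++ [c])

/-- The sum over column tableaux, with column heights `hs` read from right to left, of
`q ^ energy * monomial * w`, where `w` depends on the columns carried to the right end. -/
def transferSum (n : ℕ) (q : A) (x : ℕ → A) : List ℕ → (List (Finset ℕ) → A) → A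
  | [], w => w []
  | h :: hs, w => ∑ c ∈ (Finset.Icc 1 n).powersetCard h,
      (∏ a ∈ c, x a) * transferSum n q x hs (appendWeight n q c w)

variable {n : ℕ} {q : A} {x : ℕ → A}

theorem map_transferSum {B : Type*} [CommRing B] (f : A →+* B) (hs : List ℕ)
    (w : List (Finset ℕ) → A) :
    f (transferSum n q x hs w) = transferSum n (f q) (f ∘ x) hs (f ∘ w) := by
  induction hs generalizing w with
  | nil => rfl
  | cons h hs ih =>
    simp only [transferSum, map_sum, map_mul, map_prod, ih, Function.comp_apply]
    refine Finset.sum_congr rfl fun c _ => ?_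
    congr 2
    funext Ds
    simp [appendWeight]

theorem transferSum_congr_var {x' : ℕ → A} (h : ∀ a ∈ Finset.Icc 1 n, x a = x' a) (hs : List ℕ)
    (w : List (Finset ℕ) → A) : transferSum n q x hs w = transferSum n q x' hs w := by
  induction hs generalizing w with
  | nil => rfl
  | cons k hs ih =>
    refine Finset.sum_congr rfl fun c hc => ?_
    rw [ih, Finset.prod_congr rfl fun a ha => h a ((Finset.mem_powersetCard.mp hc).1 ha)]

theorem transferSum_congr {hs : List ℕ} (hhs : hs.Pairwise (· ≤ ·)) {w w' : List (Finset ℕ) → A}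
    (h : ∀ Ds : List (Finset ℕ), Ds.map Finset.card = hs.reverse →
      (∀ D ∈ Ds, D ⊆ Finset.Icc 1 n) → w Ds = w' Ds) :
    transferSum n q x hs w = transferSum n q x hs w' := by
  induction hs generalizing w w' with
  | nil => exact h [] rfl (by simp)
  | cons k hs ih =>
    rw [List.pairwise_cons] at hhs
    refine Finset.sum_congr rfl fun c hc => ?_
    rw [Finset.mem_powersetCard] at hc
    congr 1
    refine ih hhs.2 fun Ds hcard hsub => ?_
    have hle : ∀ D ∈ Ds, c.card ≤ D.card := by
      intro D hD
      rw [hc.2]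
      refine hhs.1 _ ?_
      rw [← List.mem_reverse, ← hcard]
      exact List.mem_map_of_mem hD
    rw [appendWeight, appendWeight, h]
    · rw [List.reverse_cons, ← hcard, List.map_append, List.map_map, List.map_cons, List.map_nil,
        hc.2]
      congr 1
      refine List.map_congr_left fun D hD => ?_
      exact card_carry (hsub D hD) hc.1 (hle D hD)
    · intro D hD
      rcases List.mem_append.mp hD with hD | hD
      · obtain ⟨D', hD', rfl⟩ := List.mem_map.mp hD
        exact carry_subset (hsub D' hD') hc.1
      · rw [List.mem_singleton.mp hD]
        exact hc.1

theorem transferSum_const_mul (r : A) (hs : List ℕ) (w : List (Finset ℕ) → A) :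
    transferSum n q x hs (fun Ds => r * w Ds) = r * transferSum n q x hs w := by
  induction hs generalizing w with
  | nil => rfl
  | cons h hs ih =>
    simp only [transferSum, Finset.mul_sum]
    refine Finset.sum_congr rfl fun c _ => ?_
    rw [mul_left_comm, ← ih]
    congr 2
    funext Ds
    simp only [appendWeight]
    ring

theorem transferSum_eq_zero {hs : List ℕ} {h : ℕ} (hh : h ∈ hs) (hn : n < h)
    (w : List (Finset ℕ) → A) : transferSum n q x hs w = 0 := by
  induction hs generalizing w with
  | nil => simp at hh
  | cons k hs ih =>
    rcases List.mem_cons.mp hh with rfl | hh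
    · rw [transferSum, Finset.powersetCard_eq_empty.mpr (by simpa using hn), Finset.sum_empty]
    · exact Finset.sum_eq_zero fun c _ => by rw [ih hh, mul_zero]

/-! ### Full columns and vanishing variables -/

theorem demand_full {c : Finset ℕ} {k : ℕ} (hk : k ≤ n) :
    demand n (Finset.Icc 1 n) c 0 k = 0 := by
  induction k with
  | zero => rfl
  | succ k ih =>
    have : n - k ∈ Finset.Icc 1 n := by rw [Finset.mem_Icc]; omega
    simp only [demand, ih (by omega), this, if_true]
    split_ifs <;> rfl

theorem winding_full {c : Finset ℕ} : winding n (Finset.Icc 1 n) c = 0 := demand_full le_rfl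

theorem carry_full {c : Finset ℕ} (hc : c ⊆ Finset.Icc 1 n) :
    carry n (Finset.Icc 1 n) c = Finset.Icc 1 n := by
  refine Finset.Subset.antisymm (carry_subset subset_rfl hc) fun l hl => ?_
  rw [mem_carry, winding_full]
  exact Or.inr ⟨hl, demand_full (Nat.sub_le _ _)⟩

theorem transferSum_append_full (hs : List ℕ) (w : List (Finset ℕ) → A) :
    transferSum n q x (hs ++ [n]) w =
      (∏ a ∈ Finset.Icc 1 n, x a) * transferSum n q x hs fun Ds => w (Finset.Icc 1 n :: Ds) := by
  induction hs generalizing w with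
  | nil =>
    have : (Finset.Icc 1 n).powersetCard n = {Finset.Icc 1 n} := by
      conv_lhs => rw [show n = (Finset.Icc 1 n).card by simp]
      simpa using Finset.powersetCard_self (Finset.Icc 1 n)
    simp [transferSum, this, appendWeight]
  | cons h hs ih =>
    rw [List.cons_append, transferSum, transferSum, Finset.mul_sum]
    refine Finset.sum_congr rfl fun c hc => ?_
    rw [ih, mul_left_comm]
    congr 3
    funext Ds
    simp [appendWeight, winding_full, carry_full (Finset.mem_powersetCard.mp hc).1]

theorem demand_succ_of_subset {D c : Finset ℕ} (hD : D ⊆ Finset.Icc 1 n)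
    (hc : c ⊆ Finset.Icc 1 n) (v k : ℕ) : demand (n + 1) D c v (k + 1) = demand n D c v k := by
  have h : ∀ z : Finset ℕ, z ⊆ Finset.Icc 1 n → n + 1 ∉ z := fun z hz h => by simpa using hz h
  induction k with
  | zero => simp [demand, h D hD, h c hc]
  | succ k ih =>
    rw [demand, ih, demand, Nat.succ_sub_succ]

theorem winding_succ_of_subset {D c : Finset ℕ} (hD : D ⊆ Finset.Icc 1 n)
    (hc : c ⊆ Finset.Icc 1 n) : winding (n + 1) D c = winding n D c :=
  demand_succ_of_subset hD hc 0 n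

theorem carry_succ_of_subset {D c : Finset ℕ} (hD : D ⊆ Finset.Icc 1 n)
    (hc : c ⊆ Finset.Icc 1 n) : carry (n + 1) D c = carry n D c := by
  ext l
  rw [mem_carry, mem_carry, winding_succ_of_subset hD hc]
  refine or_congr Iff.rfl (and_congr_right fun hl => ?_)
  have := Finset.mem_Icc.mp (hD hl)
  rw [Nat.succ_sub this.2, demand_succ_of_subset hD hc]

theorem transferSum_succ_of_eq_zero {hs : List ℕ} (hhs : hs.Pairwise (· ≤ ·))
    (hx : x (n + 1) = 0) (w : List (Finset ℕ) → A) :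
    transferSum (n + 1) q x hs w = transferSum n q x hs w := by
  induction hs generalizing w with
  | nil => rfl
  | cons h hs ih =>
    rw [List.pairwise_cons] at hhs
    rw [transferSum, transferSum]
    symm
    apply Finset.sum_subset_zero_on_sdiff
    · exact Finset.powersetCard_mono (Finset.Icc_subset_Icc_right n.le_succ)
    · intro c hc
      rw [Finset.mem_sdiff, Finset.mem_powersetCard, Finset.mem_powersetCard] at hc
      obtain ⟨⟨h1, h2⟩, h3⟩ := hc
      have : n + 1 ∈ c := by
        by_contra hnc
        refine h3 ⟨fun l hl => ?_, h2⟩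
        have := Finset.mem_Icc.mp (h1 hl)
        have hne : l ≠ n + 1 := fun e => hnc (e ▸ hl)
        rw [Finset.mem_Icc]
        omega
      rw [Finset.prod_eq_zero this hx, zero_mul]
    · intro c hc
      rw [Finset.mem_powersetCard] at hc
      rw [ih hhs.2]
      congr 1
      refine transferSum_congr hhs.2 fun Ds _ hsub => ?_
      rw [appendWeight, appendWeight,
        List.map_congr_left fun D hD => winding_succ_of_subset (hsub D hD) hc.1,
        List.map_congr_left fun D hD => carry_succ_of_subset (hsub D hD) hc.1]

/-! ### Rotation of the variables -/

theorem rotate_injOn {c c' : Finset ℕ} (hc : c ⊆ Finset.Icc 1 n) (hc' : c' ⊆ Finset.Icc 1 n)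
    (h : rotate n c = rotate n c') : c = c' := by
  have key : ∀ d d' : Finset ℕ, d ⊆ Finset.Icc 1 n → d' ⊆ Finset.Icc 1 n →
      rotate n d = rotate n d' → d ⊆ d' := by
    intro d d' hd hd' h l hl
    have := Finset.mem_Icc.mp (hd hl)
    rcases this.2.lt_or_eq with hlt | rfl
    · rwa [← succ_mem_rotate this.1 hlt, ← h, succ_mem_rotate this.1 hlt]
    · rwa [← one_mem_rotate hd', ← h, one_mem_rotate hd]
  exact Finset.Subset.antisymm (key _ _ hc hc' h) (key _ _ hc' hc h.symm)

theorem image_rotate_powersetCard (n h : ℕ) :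
    ((Finset.Icc 1 n).powersetCard h).image (rotate n) = (Finset.Icc 1 n).powersetCard h := by
  apply Finset.eq_of_subset_of_card_le
  · intro c hc
    obtain ⟨d, hd, rfl⟩ := Finset.mem_image.mp hc
    rw [Finset.mem_powersetCard] at hd ⊢
    exact ⟨rotate_subset hd.1, by rw [card_rotate hd.1, hd.2]⟩
  · rw [Finset.card_image_of_injOn]
    intro c hc c' hc' h
    exact rotate_injOn (Finset.mem_powersetCard.mp hc).1 (Finset.mem_powersetCard.mp hc').1 h

/-- The variables `(q x_n, x_1, …, x_{n-1})`. -/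
def rotateVar (n : ℕ) (q : A) (x : ℕ → A) (l : ℕ) : A := if l = 1 then q * x n else x (l - 1)

theorem prod_rotateVar {c : Finset ℕ} (hc : c ⊆ Finset.Icc 1 n) :
    ∏ a ∈ rotate n c, rotateVar n q x a = q ^ (if n ∈ c then 1 else 0) * ∏ a ∈ c, x a := by
  have hr : ∀ a ∈ c, rotateVar n q x (if a = n then 1 else a + 1) =
      (if a = n then q else 1) * x a := by
    intro a ha
    have := Finset.mem_Icc.mp (hc ha)
    split_ifs with h
    · simp [rotateVar, h]
    · have : a ≠ 0 := by omega
      simp [rotateVar, this]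
  rw [rotate, Finset.prod_image (injOn_rotate.mono (by exact_mod_cast hc)),
    Finset.prod_congr rfl hr, Finset.prod_mul_distrib, Finset.prod_ite_eq']
  split_ifs <;> simp

/-- The number of columns containing all the letters `k, …, n`. -/
def topCount (n k : ℕ) (Ds : List (Finset ℕ)) : ℕ := Ds.countP fun D => Finset.Icc k n ⊆ D

theorem topCount_self_cons (n : ℕ) (D : Finset ℕ) (Ds : List (Finset ℕ)) :
    topCount n n (D :: Ds) = topCount n n Ds + if n ∈ D then 1 else 0 := by
  simp [topCount, List.countP_cons]

theorem topCount_self_append (n : ℕ) (D : Finset ℕ) (Ds : List (Finset ℕ)) :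
    topCount n n (Ds ++ [D]) = topCount n n Ds + if n ∈ D then 1 else 0 := by
  simp [topCount, List.countP_cons]

theorem sum_winding_rotate (hn : 1 ≤ n) {c : Finset ℕ} (hc : c ⊆ Finset.Icc 1 n)
    {Ds : List (Finset ℕ)} (hsub : ∀ D ∈ Ds, D ⊆ Finset.Icc 1 n)
    (hcard : ∀ D ∈ Ds, c.card ≤ D.card) :
    topCount n n Ds + (Ds.map fun D => winding n (rotate n D) (rotate n c)).sum =
      (Ds.map fun D => winding n D c).sum + topCount n n (Ds.map fun D => carry n D c) := by
  induction Ds with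
  | nil => rfl
  | cons D Ds ih =>
    rw [List.forall_mem_cons] at hsub hcard
    have h1 := ih hsub.2 hcard.2
    have h2 := winding_rotate hn hsub.1 hc hcard.1
    simp only [List.map_cons, List.sum_cons, topCount_self_cons]
    omega

theorem transferSum_rotateVar (hn : 1 ≤ n) {hs : List ℕ} (hhs : hs.Pairwise (· ≤ ·))
    (w : List (Finset ℕ) → A) :
    transferSum n q (rotateVar n q x) hs w =
      transferSum n q x hs fun Ds => q ^ topCount n n Ds * w (Ds.map (rotate n)) := by
  induction hs generalizing w with
  | nil => simp [transferSum, topCount]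
  | cons h hs ih =>
    rw [List.pairwise_cons] at hhs
    rw [transferSum, transferSum, ← image_rotate_powersetCard, Finset.sum_image
      fun c hc c' hc' => rotate_injOn (Finset.mem_powersetCard.mp hc).1
        (Finset.mem_powersetCard.mp hc').1, image_rotate_powersetCard]
    refine Finset.sum_congr rfl fun c hc => ?_
    rw [Finset.mem_powersetCard] at hc
    rw [prod_rotateVar hc.1, ih hhs.2, mul_comm (q ^ _), mul_assoc, ← transferSum_const_mul]
    congr 1
    refine transferSum_congr hhs.2 fun Ds hcard hsub => ?_
    have hle : ∀ D ∈ Ds, c.card ≤ D.card := by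
      intro D hD
      rw [hc.2]
      refine hhs.1 _ ?_
      rw [← List.mem_reverse, ← hcard]
      exact List.mem_map_of_mem hD
    have key := sum_winding_rotate hn hc.1 hsub hle
    have hmap : (Ds.map (rotate n)).map (fun D => carry n D (rotate n c)) ++ [rotate n c] =
        (Ds.map (fun D => carry n D c) ++ [c]).map (rotate n) := by
      rw [List.map_append, List.map_map, List.map_map]
      congr 1
      exact List.map_congr_left fun D hD => carry_rotate hn (hsub D hD) hc.1 (hle D hD)
    simp only [appendWeight]
    rw [hmap, List.map_map, topCount_self_append, ← mul_assoc, ← mul_assoc, ← mul_assoc,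
      ← pow_add, ← pow_add,
      ← pow_add]
    congr 2
    simp only [Function.comp_def]
    omega

end TransferSum

/-! ### Exchange of two adjacent variables -/

section Exchange

variable {A : Type*} [CommRing A] {n : ℕ} {q : A} {x : ℕ → A}

theorem image_swap_of_iff {a b : ℕ} {c : Finset ℕ} (h : a ∈ c ↔ b ∈ c) :
    c.image (Equiv.swap a b) = c := by
  ext l
  rw [Finset.mem_image]
  constructor
  · rintro ⟨m, hm, rfl⟩
    by_cases h1 : m = a
    · subst h1
      rwa [Equiv.swap_apply_left, ← h]
    · by_cases h2 : m = b
      · subst h2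
        rwa [Equiv.swap_apply_right, h]
      · rwa [Equiv.swap_apply_of_ne_of_ne h1 h2]
  · intro hl
    by_cases h1 : l = a
    · subst h1
      exact ⟨b, h.mp hl, Equiv.swap_apply_right _ _⟩
    · by_cases h2 : l = b
      · subst h2
        exact ⟨a, h.mpr hl, Equiv.swap_apply_left _ _⟩
      · exact ⟨l, hl, Equiv.swap_apply_of_ne_of_ne h1 h2⟩

theorem image_swap_insert {a b : ℕ} {c : Finset ℕ} (ha : a ∉ c) (hb : b ∉ c) :
    (insert a c).image (Equiv.swap a b) = insert b c := by
  rw [Finset.image_insert, Equiv.swap_apply_left,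
    image_swap_of_iff (iff_of_false ha hb)]

theorem prod_image_swap (a b : ℕ) (c : Finset ℕ) :
    ∏ l ∈ c, (x ∘ Equiv.swap a b) l = ∏ l ∈ c.image (Equiv.swap a b), x l := by
  rw [Finset.prod_image (Equiv.injective _).injOn]
  rfl

theorem appendWeight_sortAt {a : ℕ} {c c' : Finset ℕ} {w w' : List (Finset ℕ) → A}
    (hw : ∀ Ds : List (Finset ℕ), w (Ds.map (fun D => carry n (sortAt a D) c) ++ [c]) =
      w' (Ds.map (fun D => carry n D c') ++ [c']))
    (h : ∀ D, winding n (sortAt a D) c = winding n D c') (Ds : List (Finset ℕ)) :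
    appendWeight n q c w (Ds.map (sortAt a)) = appendWeight n q c' w' Ds := by
  simp only [appendWeight, List.map_map, Function.comp_def, h, hw]

theorem transferSum_exchange {a : ℕ} (ha : 1 ≤ a) (hb : a + 1 ≤ n) (hs : List ℕ)
    (w : List (Finset ℕ) → A) :
    (x a - x (a + 1)) * transferSum n q x hs (fun Ds => w (Ds.map (sortAt a))) =
      x a * transferSum n q x hs w -
        x (a + 1) * transferSum n q (x ∘ Equiv.swap a (a + 1)) hs w := by
  induction hs generalizing w with
  | nil => simp only [transferSum, List.map_nil]; ring
  | cons h hs ih =>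
    rw [← sub_eq_zero]
    simp only [transferSum, Finset.mul_sum, ← Finset.sum_sub_distrib]
    have hself : ∀ c : Finset ℕ, (a ∈ c ↔ a + 1 ∈ c) →
        (x a - x (a + 1)) * ((∏ l ∈ c, x l) * transferSum n q x hs
            (appendWeight n q c fun Ds => w (Ds.map (sortAt a)))) -
          (x a * ((∏ l ∈ c, x l) * transferSum n q x hs (appendWeight n q c w)) -
            x (a + 1) * ((∏ l ∈ c, (x ∘ Equiv.swap a (a + 1)) l) *
              transferSum n q (x ∘ Equiv.swap a (a + 1)) hs (appendWeight n q c w))) = 0 := by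
      intro c hc
      have hfacts : ∀ D, winding n (sortAt a D) c = winding n D c ∧
          carry n (sortAt a D) c = sortAt a (carry n D c) := by
        intro D
        by_cases h1 : a ∈ c
        · exact winding_sortAt_of_mem ha hb h1 (hc.mp h1)
        · exact winding_sortAt_of_not_mem ha hb h1 (fun h2 => h1 (hc.mpr h2))
      have hsc : sortAt a c = c := by
        by_cases h1 : a ∈ c
        · exact sortAt_of_mem h1
        · have h2 : a + 1 ∉ c := fun h2 => h1 (hc.mpr h2)
          simp [sortAt, h2]
      have hW : (appendWeight n q c fun Ds => w (Ds.map (sortAt a))) =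
          fun Ds => appendWeight n q c w (Ds.map (sortAt a)) := by
        funext Ds
        symm
        refine appendWeight_sortAt (fun Ds => ?_) (fun D => (hfacts D).1) Ds
        simp only [(hfacts _).2, List.map_append, List.map_map, Function.comp_def, List.map_cons,
          List.map_nil, hsc]
      rw [prod_image_swap, image_swap_of_iff hc, hW]
      linear_combination (∏ l ∈ c, x l) * ih (appendWeight n q c w)
    have hpair : ∀ c : Finset ℕ, a ∉ c → a + 1 ∉ c →
        ((x a - x (a + 1)) * ((∏ l ∈ insert a c, x l) * transferSum n q x hs
            (appendWeight n q (insert a c) fun Ds => w (Ds.map (sortAt a)))) -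
          (x a * ((∏ l ∈ insert a c, x l) *
              transferSum n q x hs (appendWeight n q (insert a c) w)) -
            x (a + 1) * ((∏ l ∈ insert a c, (x ∘ Equiv.swap a (a + 1)) l) *
              transferSum n q (x ∘ Equiv.swap a (a + 1)) hs
                (appendWeight n q (insert a c) w)))) +
        ((x a - x (a + 1)) * ((∏ l ∈ insert (a + 1) c, x l) * transferSum n q x hs
            (appendWeight n q (insert (a + 1) c) fun Ds => w (Ds.map (sortAt a)))) -
          (x a * ((∏ l ∈ insert (a + 1) c, x l) *
              transferSum n q x hs (appendWeight n q (insert (a + 1) c) w)) -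
            x (a + 1) * ((∏ l ∈ insert (a + 1) c, (x ∘ Equiv.swap a (a + 1)) l) *
              transferSum n q (x ∘ Equiv.swap a (a + 1)) hs
                (appendWeight n q (insert (a + 1) c) w)))) = 0 := by
      intro c h1 h2
      have hself' := fun D => winding_sortAt_insert_self (x := D) ha hb h1 h2
      have hsucc' := fun D => winding_sortAt_insert_succ (x := D) ha hb h1 h2
      have hs1 : sortAt a (insert a c) = insert a c := sortAt_of_mem (Finset.mem_insert_self _ _)
      have hs2 : sortAt a (insert (a + 1) c) = insert a c := by
        simp [sortAt, h1, h2]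
      have hWa : (appendWeight n q (insert a c) fun Ds => w (Ds.map (sortAt a))) =
          appendWeight n q (insert a c) w := by
        funext Ds
        have : ∀ D, sortAt a (carry n D (insert a c)) = carry n D (insert a c) := fun D =>
          sortAt_of_mem (mem_carry.mpr (Or.inl (Finset.mem_insert_self _ _)))
        simp only [appendWeight, List.map_append, List.map_map, Function.comp_def, List.map_cons,
          List.map_nil, hs1, this]
      have hWb : (appendWeight n q (insert (a + 1) c) fun Ds => w (Ds.map (sortAt a))) =
          fun Ds => appendWeight n q (insert a c) w (Ds.map (sortAt a)) := by
        funext Ds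
        symm
        refine appendWeight_sortAt (fun Ds => ?_) (fun D => (hself' D).1) Ds
        simp only [(hself' _).2, List.map_append, List.map_map, Function.comp_def, List.map_cons,
          List.map_nil, hs2]
      have hWb' : (fun Ds => appendWeight n q (insert (a + 1) c) w (Ds.map (sortAt a))) =
          appendWeight n q (insert (a + 1) c) w := by
        funext Ds
        refine appendWeight_sortAt (fun Ds => ?_) (fun D => (hsucc' D).1) Ds
        simp only [(hsucc' _).2]
      have e1 := ih (appendWeight n q (insert a c) w)
      have e2 := ih (appendWeight n q (insert (a + 1) c) w)
      rw [hWb'] at e2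
      have hp : ∏ l ∈ c, (x ∘ Equiv.swap a (a + 1)) l = ∏ l ∈ c, x l := by
        rw [prod_image_swap, image_swap_of_iff (iff_of_false h1 h2)]
      rw [hWa, hWb, Finset.prod_insert h1, Finset.prod_insert h2, Finset.prod_insert h1,
        Finset.prod_insert h2, hp]
      simp only [Function.comp_apply, Equiv.swap_apply_left, Equiv.swap_apply_right]
      linear_combination (∏ l ∈ c, x l) * x (a + 1) * e1 + (∏ l ∈ c, x l) * x a * e2
    refine Finset.sum_involution (fun c _ => c.image (Equiv.swap a (a + 1))) ?_ ?_ ?_ ?_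
    · intro c _
      by_cases h1 : a ∈ c <;> by_cases h2 : a + 1 ∈ c
      · rw [image_swap_of_iff (iff_of_true h1 h2), hself c (iff_of_true h1 h2), add_zero]
      · obtain ⟨d, hd, rfl⟩ : ∃ d, a ∉ d ∧ c = insert a d :=
          ⟨c.erase a, Finset.notMem_erase _ _, (Finset.insert_erase h1).symm⟩
        have hd' : a + 1 ∉ d := fun hm => h2 (Finset.mem_insert_of_mem hm)
        rw [image_swap_insert hd hd']
        exact hpair d hd hd'
      · obtain ⟨d, hd, rfl⟩ : ∃ d, a + 1 ∉ d ∧ c = insert (a + 1) d :=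
          ⟨c.erase (a + 1), Finset.notMem_erase _ _, (Finset.insert_erase h2).symm⟩
        have hd' : a ∉ d := fun hm => h1 (Finset.mem_insert_of_mem hm)
        rw [Equiv.swap_comm, image_swap_insert hd hd', add_comm, Equiv.swap_comm]
        exact hpair d hd' hd
      · rw [image_swap_of_iff (iff_of_false h1 h2), hself c (iff_of_false h1 h2), add_zero]
    · intro c _ hne heq
      refine hne (hself c ⟨fun h1 => ?_, fun h1 => ?_⟩)
      · rw [← heq]
        exact Finset.mem_image.mpr ⟨a, h1, Equiv.swap_apply_left _ _⟩
      · rw [← heq]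
        exact Finset.mem_image.mpr ⟨a + 1, h1, Equiv.swap_apply_right _ _⟩
    · intro c hc
      rw [Finset.mem_powersetCard] at hc ⊢
      refine ⟨fun l hl => ?_, ?_⟩
      · obtain ⟨m, hm, rfl⟩ := Finset.mem_image.mp hl
        have := Finset.mem_Icc.mp (hc.1 hm)
        rw [Finset.mem_Icc, Equiv.swap_apply_def]
        split_ifs <;> omega
      · rw [Finset.card_image_of_injective _ (Equiv.injective _), hc.2]
    · intro c _
      rw [Finset.image_image, ← Equiv.coe_trans, Equiv.swap_swap]
      exact Finset.image_id

end Exchange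


/-! ### The `q`-difference equation -/

section LagrangeSum

variable {ι K : Type*} [DecidableEq ι] [Field K]

/-- The coefficient `∏_{j ≠ i} x_j / (x_j - x_i)`. -/
def lagrangeCoeff (S : Finset ι) (x : ι → K) (i : ι) : K := ∏ j ∈ S.erase i, x j / (x j - x i)

theorem lagrangeCoeff_insert {S : Finset ι} {a i : ι} (ha : a ∉ S) (hi : i ≠ a) (x : ι → K) :
    lagrangeCoeff (insert a S) x i = x a / (x a - x i) * lagrangeCoeff S x i := by
  rw [lagrangeCoeff, Finset.erase_insert_of_ne hi.symm, Finset.prod_insert, lagrangeCoeff]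
  exact fun h => ha (Finset.mem_of_mem_erase h)

theorem lagrangeCoeff_insert_self {S : Finset ι} {a : ι} (ha : a ∉ S) (x : ι → K) :
    lagrangeCoeff (insert a S) x a = ∏ j ∈ S, x j / (x j - x a) := by
  rw [lagrangeCoeff, Finset.erase_insert ha]

/-- The sum of the values `p` against the coefficients `lagrangeCoeff S x`. -/
def lagrangeSum (S : Finset ι) (x p : ι → K) : K := ∑ i ∈ S, lagrangeCoeff S x i * p i

theorem lagrangeSum_insert_insert {S : Finset ι} {a b : ι} (hab : a ≠ b) (ha : a ∉ S) (hb : b ∉ S)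
    {x : ι → K} (hx : Set.InjOn x (insert a (insert b S) : Finset ι)) (p : ι → K) :
    (x a - x b) * lagrangeSum (insert a (insert b S)) x p =
      x a * lagrangeSum (insert b S) x p - x b * lagrangeSum (insert a S) x p := by
  have ha' : a ∉ insert b S := by simp [hab, ha]
  have hb' : b ∉ insert a S := by simp [hab.symm, hb]
  have hne : ∀ i ∈ insert a (insert b S), ∀ j ∈ insert a (insert b S), i ≠ j → x i - x j ≠ 0 :=
    fun i hi j hj hij h => hij (hx hi hj (sub_eq_zero.mp h))
  have h1 : x a - x b ≠ 0 := hne a (by simp) b (by simp) hab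
  have h2 : x b - x a ≠ 0 := hne b (by simp) a (by simp) hab.symm
  have hS : ∀ i ∈ S, (x a - x b) * (lagrangeCoeff (insert a (insert b S)) x i * p i) =
      x a * (lagrangeCoeff (insert b S) x i * p i) -
        x b * (lagrangeCoeff (insert a S) x i * p i) := by
    intro i hi
    have hia : i ≠ a := fun h => ha (h ▸ hi)
    have hib : i ≠ b := fun h => hb (h ▸ hi)
    have h3 : x a - x i ≠ 0 := hne a (by simp) i (by simp [hi]) hia.symm
    have h4 : x b - x i ≠ 0 := hne b (by simp) i (by simp [hi]) hib.symm
    rw [lagrangeCoeff_insert ha' hia, lagrangeCoeff_insert hb hib, lagrangeCoeff_insert ha hia]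
    field_simp
    ring
  have hA : lagrangeCoeff (insert a (insert b S)) x a =
      x b / (x b - x a) * lagrangeCoeff (insert a S) x a := by
    rw [Finset.insert_comm, lagrangeCoeff_insert hb' hab]
  have hB : lagrangeCoeff (insert a (insert b S)) x b =
      x a / (x a - x b) * lagrangeCoeff (insert b S) x b :=
    lagrangeCoeff_insert ha' hab.symm x
  have hsum := Finset.sum_congr (rfl : S = S) hS
  rw [← Finset.mul_sum, Finset.sum_sub_distrib, ← Finset.mul_sum, ← Finset.mul_sum] at hsum
  rw [lagrangeSum, lagrangeSum, lagrangeSum, Finset.sum_insert ha', Finset.sum_insert hb,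
    Finset.sum_insert hb, Finset.sum_insert ha, mul_add, mul_add, hsum, hA, hB]
  field_simp
  ring

theorem lagrangeSum_image {S : Finset ι} (σ : Equiv.Perm ι) (x p : ι → K) :
    lagrangeSum (S.image σ) x p = lagrangeSum S (x ∘ σ) (p ∘ σ) := by
  rw [lagrangeSum, lagrangeSum, Finset.sum_image σ.injective.injOn]
  refine Finset.sum_congr rfl fun i _ => ?_
  congr 1
  rw [lagrangeCoeff, lagrangeCoeff, ← Finset.image_erase σ.injective,
    Finset.prod_image σ.injective.injOn]
  rfl

end LagrangeSum

section QDifference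

variable {K : Type*} [Field K] {n : ℕ} {q : K} {x : ℕ → K} {hs : List ℕ}

/-- The generating function of column tableaux with column heights `hs` (from right to left). -/
def colSum {A : Type*} [CommRing A] (n : ℕ) (q : A) (x : ℕ → A) (hs : List ℕ) : A :=
  transferSum n q x hs fun _ => 1

theorem colSum_swap {a : ℕ} (ha : 1 ≤ a) (hb : a + 1 ≤ n) :
    colSum n q (x ∘ Equiv.swap a (a + 1)) hs = colSum n q x hs := by
  have h1 := transferSum_exchange (q := q) (x := x) ha hb hs fun _ => 1
  have h2 := transferSum_exchange (q := q) (x := x ∘ Equiv.swap a (a + 1)) ha hb hs fun _ => 1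
  simp only [Function.comp_assoc, ← Equiv.coe_trans, Equiv.swap_swap, Equiv.coe_refl,
    Function.comp_id] at h2
  simp only [Function.comp_apply, Equiv.swap_apply_left, Equiv.swap_apply_right] at h2
  by_cases hxb : x (a + 1) = 0
  · by_cases hxa : x a = 0
    · congr 1
      funext l
      by_cases hla : l = a
      · subst hla; simp [hxa, hxb]
      · by_cases hlb : l = a + 1
        · subst hlb; simp [hxa, hxb]
        · simp [Equiv.swap_apply_of_ne_of_ne hla hlb]
    · apply mul_left_cancel₀ hxa
      unfold colSum
      linear_combination -h2
  · apply mul_left_cancel₀ hxb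
    unfold colSum
    linear_combination h1

/-- The variables `x_1, …, x_{k-1}, q x_n, x_k, …, x_{n-1}`. -/
def movedVar (n : ℕ) (q : K) (x : ℕ → K) (k l : ℕ) : K :=
  if l < k then x l else if l = k then q * x n else x (l - 1)

theorem movedVar_swap {k : ℕ} :
    movedVar n q x (k + 1) ∘ Equiv.swap k (k + 1) = movedVar n q x k := by
  funext l
  by_cases h1 : l = k
  · subst h1
    simp [movedVar]
  · by_cases h2 : l = k + 1
    · subst h2
      simp [movedVar]
    · rw [Function.comp_apply, Equiv.swap_apply_of_ne_of_ne h1 h2]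
      unfold movedVar
      split_ifs <;> first | rfl | omega

theorem colSum_rotateVar (hn : 1 ≤ n) :
    colSum n q (rotateVar n q x) hs = colSum n q (Function.update x n (q * x n)) hs := by
  have h1 : ∀ k, 1 ≤ k → k ≤ n →
      colSum n q (movedVar n q x 1) hs = colSum n q (movedVar n q x k) hs := by
    intro k hk
    induction k, hk using Nat.le_induction with
    | base => exact fun _ => rfl
    | succ k hk ih =>
      intro hkn
      rw [ih (by omega), ← movedVar_swap, colSum_swap hk hkn]
  calc colSum n q (rotateVar n q x) hs = colSum n q (movedVar n q x 1) hs := by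
        refine transferSum_congr_var (fun l hl => ?_) _ _
        have := Finset.mem_Icc.mp hl
        unfold rotateVar movedVar
        split_ifs <;> first | rfl | omega
    _ = colSum n q (movedVar n q x n) hs := h1 n hn le_rfl
    _ = _ := by
        refine transferSum_congr_var (fun l hl => ?_) _ _
        have := Finset.mem_Icc.mp hl
        unfold movedVar
        rcases this.2.lt_or_eq with h | rfl
        · simp [h, h.ne]
        · simp

theorem topCount_map_sortAt {k : ℕ} (hk : k + 1 ≤ n) (Ds : List (Finset ℕ)) :
    topCount n (k + 1) (Ds.map (sortAt k)) = topCount n k Ds := by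
  rw [topCount, topCount, List.countP_map]
  congr 1
  funext D
  simp only [Function.comp_apply, decide_eq_decide, Finset.subset_iff, Finset.mem_Icc]
  constructor
  · intro h l hl
    have h0 := mem_sortAt_succ.mp (h ⟨le_rfl, hk⟩)
    by_cases h1 : l = k
    · exact h1 ▸ h0.1
    · by_cases h2 : l = k + 1
      · exact h2 ▸ h0.2
      · exact (mem_sortAt_of_ne h1 h2).mp (h (by omega))
  · intro h l hl
    by_cases h2 : l = k + 1
    · subst h2
      exact mem_sortAt_succ.mpr ⟨h (by omega), h (by omega)⟩
    · exact (mem_sortAt_of_ne (by omega) h2).mpr (h (by omega))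

theorem topCount_one {Ds : List (Finset ℕ)} (hDs : ∀ D ∈ Ds, D ⊆ Finset.Icc 1 n) :
    topCount n 1 Ds = (Ds.map Finset.card).count n := by
  rw [topCount, List.count, List.countP_map]
  refine List.countP_congr fun D hD => ?_
  simp only [decide_eq_true_eq, Function.comp_apply, beq_iff_eq]
  constructor
  · intro h
    rw [Finset.Subset.antisymm (hDs D hD) h, Nat.card_Icc, Nat.add_sub_cancel]
  · intro h
    rw [Finset.eq_of_subset_of_card_le (hDs D hD) (by simp [h])]

theorem colSum_swap_update {k : ℕ} (hk : 1 ≤ k) (hkn : k + 1 ≤ n) (i : ℕ) :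
    colSum n q (Function.update (x ∘ Equiv.swap k (k + 1)) i
        (q * (x ∘ Equiv.swap k (k + 1)) i)) hs =
      colSum n q (Function.update x (Equiv.swap k (k + 1) i)
        (q * x (Equiv.swap k (k + 1) i))) hs := by
  rw [← colSum_swap hk hkn (x := Function.update x _ _), Function.comp_apply]
  congr 1
  funext l
  simp only [Function.update_apply, Function.comp_apply, EmbeddingLike.apply_eq_iff_eq]

theorem transferSum_topCount (hhs : hs.Pairwise (· ≤ ·)) {k : ℕ} (hk : 1 ≤ k) (hkn : k ≤ n) :
    ∀ x : ℕ → K, Set.InjOn x (Finset.Icc 1 n : Finset ℕ) →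
      transferSum n q x hs (fun Ds => q ^ topCount n k Ds) =
        lagrangeSum (Finset.Icc k n) x fun i =>
          colSum n q (Function.update x i (q * x i)) hs := by
  induction hkn using Nat.decreasingInduction with
  | self =>
    intro x _
    rw [Finset.Icc_self, lagrangeSum, Finset.sum_singleton, lagrangeCoeff, Finset.erase_singleton,
      Finset.prod_empty, one_mul, ← colSum_rotateVar hk, colSum, transferSum_rotateVar hk hhs]
    simp only [mul_one]
  | of_succ k hkn ih =>
    intro x hx
    have hkn' : k + 1 ≤ n := hkn
    have hne : x k - x (k + 1) ≠ 0 := by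
      intro h
      have := hx (by simp; omega) (by simp; omega) (sub_eq_zero.mp h)
      omega
    apply mul_left_cancel₀ hne
    have hex := transferSum_exchange (q := q) (x := x) hk hkn hs fun Ds => q ^ topCount n (k + 1) Ds
    simp only [topCount_map_sortAt hkn'] at hex
    have hmaps : Set.MapsTo (Equiv.swap k (k + 1)) (Finset.Icc 1 n : Finset ℕ)
        (Finset.Icc 1 n : Finset ℕ) := by
      intro l hl
      simp only [Finset.coe_Icc, Set.mem_Icc] at hl ⊢
      rw [Equiv.swap_apply_def]
      split_ifs <;> omega
    rw [hex, ih (by omega) x hx, ih (by omega) (x ∘ Equiv.swap k (k + 1))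
      (hx.comp (Equiv.injective _).injOn hmaps)]
    simp only [colSum_swap_update hk hkn']
    have himg := lagrangeSum_image (S := Finset.Icc (k + 1) n) (Equiv.swap k (k + 1)) x fun i =>
      colSum n q (Function.update x i (q * x i)) hs
    simp only [Function.comp_def] at himg ⊢
    rw [← himg]
    have e1 : Finset.Icc (k + 1) n = insert (k + 1) (Finset.Icc (k + 2) n) := by
      ext l; simp only [Finset.mem_insert, Finset.mem_Icc]; omega
    have e2 : Finset.Icc k n = insert k (insert (k + 1) (Finset.Icc (k + 2) n)) := by
      ext l; simp only [Finset.mem_insert, Finset.mem_Icc]; omega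
    have e3 : (Finset.Icc (k + 1) n).image (Equiv.swap k (k + 1)) =
        insert k (Finset.Icc (k + 2) n) := by
      rw [e1, Equiv.swap_comm, image_swap_insert (by simp) (by simp)]
    rw [e3, e1, e2]
    refine (lagrangeSum_insert_insert (by omega) (by simp) (by simp) ?_ _).symm
    rw [← e2]
    exact hx.mono (by exact_mod_cast Finset.Icc_subset_Icc_left hk)

theorem lagrangeSum_colSum (hhs : hs.Pairwise (· ≤ ·)) (hn : 1 ≤ n)
    (hx : Set.InjOn x (Finset.Icc 1 n : Finset ℕ)) :
    (lagrangeSum (Finset.Icc 1 n) x fun i => colSum n q (Function.update x i (q * x i)) hs) =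
      q ^ hs.count n * colSum n q x hs := by
  rw [← transferSum_topCount hhs le_rfl hn x hx, colSum, ← transferSum_const_mul]
  refine transferSum_congr hhs fun Ds hcard hsub => ?_
  rw [topCount_one hsub, hcard, List.count_reverse, mul_one]

end QDifference

/-! ### The two sides as formal sums -/

section ColSum

variable {A : Type*} [CommRing A] {n : ℕ} {q : A} {x : ℕ → A}

theorem map_colSum {B : Type*} [CommRing B] (f : A →+* B) (hs : List ℕ) :
    f (colSum n q x hs) = colSum n (f q) (f ∘ x) hs := by
  rw [colSum, map_transferSum]
  congr 1
  funext _
  exact map_one f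

/-- The even column heights `2 h`, for `h` in `s`, read from right to left. -/
def evenHeights (s : Multiset ℕ) : List ℕ := (s.sort (· ≤ ·)).map (2 * ·)

theorem pairwise_evenHeights (s : Multiset ℕ) : (evenHeights s).Pairwise (· ≤ ·) := by
  rw [evenHeights, List.pairwise_map]
  exact (Multiset.pairwise_sort s (· ≤ ·)).imp fun h => Nat.mul_le_mul_left 2 h

theorem mem_evenHeights {s : Multiset ℕ} {k : ℕ} : k ∈ evenHeights s ↔ ∃ h ∈ s, 2 * h = k := by
  simp [evenHeights]

theorem count_evenHeights (s : Multiset ℕ) (m : ℕ) :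
    (evenHeights s).count (2 * m) = s.count m := by
  rw [evenHeights, List.count_map_of_injective _ _ fun a b h => by simpa using h,
    ← Multiset.coe_count, Multiset.sort_eq]

theorem evenHeights_cons_of_le {s : Multiset ℕ} {m : ℕ} (hm : ∀ h ∈ s, h ≤ m) :
    evenHeights (m ::ₘ s) = evenHeights s ++ [2 * m] := by
  have : (m ::ₘ s).sort (· ≤ ·) = s.sort (· ≤ ·) ++ [m] := by
    refine List.Perm.eq_of_pairwise (le := (· ≤ ·)) (fun a b _ _ h h' => le_antisymm h h')
      (Multiset.pairwise_sort _ _) ?_ ?_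
    · rw [List.pairwise_append]
      refine ⟨Multiset.pairwise_sort _ _, List.pairwise_singleton _ _, fun a ha b hb => ?_⟩
      rw [List.mem_singleton.mp hb]
      exact hm a (by simpa using ha)
    · rw [← Multiset.coe_eq_coe, Multiset.sort_eq, ← Multiset.coe_add, Multiset.sort_eq,
        Multiset.coe_singleton, add_comm, Multiset.singleton_add]
  rw [evenHeights, this, List.map_append]
  rfl

theorem colSum_evenHeights_cons (m : ℕ) (s : Multiset ℕ) (q : A) (x : ℕ → A) :
    colSum (2 * m) q x (evenHeights (m ::ₘ s)) =
      (∏ a ∈ Finset.Icc 1 (2 * m), x a) * colSum (2 * m) q x (evenHeights s) := by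
  by_cases hm : ∀ h ∈ s, h ≤ m
  · rw [evenHeights_cons_of_le hm, colSum, transferSum_append_full, colSum]
  · push Not at hm
    obtain ⟨h, hs, hlt⟩ := hm
    have hlt' : 2 * m < 2 * h := by omega
    rw [colSum, colSum, transferSum_eq_zero (mem_evenHeights.mpr ⟨h, hs, rfl⟩) hlt',
      transferSum_eq_zero (mem_evenHeights.mpr ⟨h, Multiset.mem_cons_of_mem hs, rfl⟩) hlt',
      mul_zero]

/-- The product of `β` over the multiplicities of the multiset `s`. -/
def multCoeff (β : ℕ → A) (s : Multiset ℕ) : A := ∏ h ∈ s.toFinset, β (s.count h)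

theorem multCoeff_eq_prod {β : ℕ → A} (hβ : β 0 = 1) {s : Multiset ℕ} {T : Finset ℕ}
    (hT : s.toFinset ⊆ T) : multCoeff β s = ∏ h ∈ T, β (s.count h) := by
  refine Finset.prod_subset hT fun h _ hh => ?_
  rw [Multiset.count_eq_zero_of_notMem fun hs => hh (Multiset.mem_toFinset.mpr hs), hβ]

theorem multCoeff_cons {β : ℕ → A} (hβ : β 0 = 1)
    (hβ' : ∀ k, (1 - q ^ (k + 1)) * β (k + 1) = β k) (m : ℕ) (s : Multiset ℕ) :
    (1 - q ^ (m ::ₘ s).count m) * multCoeff β (m ::ₘ s) = multCoeff β s := by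
  have hm : m ∈ (m ::ₘ s).toFinset := by simp
  have hs : multCoeff β s = ∏ h ∈ (m ::ₘ s).toFinset, β (s.count h) :=
    multCoeff_eq_prod hβ (by simp [Multiset.toFinset_cons, Finset.subset_insert])
  rw [hs, multCoeff, ← Finset.mul_prod_erase _ (fun h => β (s.count h)) hm,
    ← Finset.mul_prod_erase _ (fun h => β ((m ::ₘ s).count h)) hm, ← mul_assoc,
    Multiset.count_cons_self, hβ']
  congr 1
  refine Finset.prod_congr rfl fun h hh => ?_
  rw [Multiset.count_cons_of_ne (Finset.ne_of_mem_erase hh)]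

theorem sum_partition_eq_sum_cons {e m : ℕ} (hm : 0 < m) {f : Multiset ℕ → A}
    (hf : ∀ s, m ∉ s → f s = 0) :
    ∑ π : Nat.Partition e, f π.parts =
      if m ≤ e then ∑ π : Nat.Partition (e - m), f (m ::ₘ π.parts) else 0 := by
  split_ifs with hme
  · symm
    rw [← Finset.sum_filter_of_ne (p := fun π : Nat.Partition e => m ∈ π.parts)
      fun π _ hne => by_contra fun h => hne (hf _ h)]
    refine Finset.sum_bij'
      (fun π _ => ⟨m ::ₘ π.parts, fun {i} hi => ?_, ?_⟩)
      (fun π hπ => ⟨π.parts.erase m, fun {i} hi => π.parts_pos (Multiset.mem_of_mem_erase hi), ?_⟩)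
      ?_ ?_ ?_ ?_ ?_
    · rcases Multiset.mem_cons.mp hi with rfl | hi
      · exact hm
      · exact π.parts_pos hi
    · rw [Multiset.sum_cons, π.parts_sum]
      omega
    · have h := Multiset.cons_erase (Finset.mem_filter.mp hπ).2
      have := π.parts_sum
      rw [← h, Multiset.sum_cons] at this
      omega
    · intro π _
      simp
    · intro π _
      simp
    · intro π _
      ext1
      simp
    · intro π hπ
      ext1
      exact Multiset.cons_erase (Finset.mem_filter.mp hπ).2
    · intro π _
      rfl
  · refine Finset.sum_eq_zero fun π _ => hf _ fun h => hme ?_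
    have := Multiset.le_sum_of_mem h
    rwa [π.parts_sum] at this

/-- The part of degree `2 e` of the sum over partitions with even columns. -/
def evenSum (β : ℕ → A) (n : ℕ) (q : A) (x : ℕ → A) (e : ℕ) : A :=
  ∑ π : Nat.Partition e, multCoeff β π.parts * colSum n q x (evenHeights π.parts)

theorem map_evenSum {B : Type*} [CommRing B] (f : A →+* B) (β : ℕ → A) (e : ℕ) :
    f (evenSum β n q x e) = evenSum (f ∘ β) n (f q) (f ∘ x) e := by
  simp [evenSum, multCoeff, map_colSum]

theorem evenSum_zero (β : ℕ → A) (q : A) (x : ℕ → A) (e : ℕ) :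
    evenSum β 0 q x e = if e = 0 then 1 else 0 := by
  split_ifs with he
  · subst he
    simp [evenSum, multCoeff, colSum, evenHeights, transferSum]
  · refine Finset.sum_eq_zero fun π _ => ?_
    obtain ⟨h, hh⟩ : ∃ h, h ∈ π.parts := by
      refine Multiset.exists_mem_of_ne_zero fun h0 => he ?_
      rw [← π.parts_sum, h0, Multiset.sum_zero]
    have := π.parts_pos hh
    rw [colSum, transferSum_eq_zero (mem_evenHeights.mpr ⟨h, hh, rfl⟩) (by omega), mul_zero]

theorem evenSum_succ_of_eq_zero (β : ℕ → A) (hx : x (n + 1) = 0) (e : ℕ) :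
    evenSum β (n + 1) q x e = evenSum β n q x e := by
  simp only [evenSum, colSum, transferSum_succ_of_eq_zero (pairwise_evenHeights _) hx]

end ColSum

section EvenSum

variable {K : Type*} [Field K] {n : ℕ} {q : K} {x : ℕ → K} {β : ℕ → K}

theorem lagrangeSum_evenSum (hn : 1 ≤ n) (hx : Set.InjOn x (Finset.Icc 1 n : Finset ℕ)) (e : ℕ) :
    (lagrangeSum (Finset.Icc 1 n) x fun i =>
        evenSum β n q (Function.update x i (q * x i)) e) =
      ∑ π : Nat.Partition e, q ^ (evenHeights π.parts).count n *
        (multCoeff β π.parts * colSum n q x (evenHeights π.parts)) := by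
  simp only [lagrangeSum, evenSum, Finset.mul_sum]
  rw [Finset.sum_comm]
  refine Finset.sum_congr rfl fun π _ => ?_
  rw [mul_left_comm, ← lagrangeSum_colSum (pairwise_evenHeights _) hn hx, lagrangeSum,
    Finset.mul_sum]
  exact Finset.sum_congr rfl fun i _ => mul_left_comm _ _ _

theorem lagrangeSum_evenSum_odd (hn : Odd n) (hx : Set.InjOn x (Finset.Icc 1 n : Finset ℕ))
    (e : ℕ) :
    (lagrangeSum (Finset.Icc 1 n) x fun i =>
        evenSum β n q (Function.update x i (q * x i)) e) = evenSum β n q x e := by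
  rw [lagrangeSum_evenSum hn.pos hx]
  refine Finset.sum_congr rfl fun π _ => ?_
  rw [List.count_eq_zero_of_not_mem, pow_zero, one_mul]
  intro h
  obtain ⟨k, -, rfl⟩ := mem_evenHeights.mp h
  exact (Nat.not_odd_iff_even.mpr (even_two_mul k)) hn

theorem lagrangeSum_evenSum_even {m : ℕ} (hm : 1 ≤ m) (hβ : β 0 = 1)
    (hβ' : ∀ k, (1 - q ^ (k + 1)) * β (k + 1) = β k)
    (hx : Set.InjOn x (Finset.Icc 1 (2 * m) : Finset ℕ)) (e : ℕ) :
    (lagrangeSum (Finset.Icc 1 (2 * m)) x fun i =>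
        evenSum β (2 * m) q (Function.update x i (q * x i)) e) =
      evenSum β (2 * m) q x e -
        if m ≤ e then (∏ a ∈ Finset.Icc 1 (2 * m), x a) * evenSum β (2 * m) q x (e - m)
        else 0 := by
  have key := sum_partition_eq_sum_cons (e := e) (m := m) hm (f := fun s =>
    (1 - q ^ s.count m) * (multCoeff β s * colSum (2 * m) q x (evenHeights s)))
    fun s hs => by rw [Multiset.count_eq_zero_of_notMem hs]; simp
  simp only [colSum_evenHeights_cons, ← mul_assoc, multCoeff_cons hβ hβ'] at key
  have hsum : (if m ≤ e then (∏ a ∈ Finset.Icc 1 (2 * m), x a) * evenSum β (2 * m) q x (e - m)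
      else 0) = ∑ π : Nat.Partition e,
        (1 - q ^ π.parts.count m) * multCoeff β π.parts *
          colSum (2 * m) q x (evenHeights π.parts) := by
    rw [key, evenSum, Finset.mul_sum]
    split_ifs
    · exact Finset.sum_congr rfl fun π _ => by ring
    · rfl
  rw [lagrangeSum_evenSum (by omega) hx, hsum, evenSum, ← Finset.sum_sub_distrib]
  refine Finset.sum_congr rfl fun π _ => ?_
  rw [count_evenHeights]
  ring

end EvenSum

/-! ### The generating series of the product side -/

section PairSeries

variable {A : Type*} [CommRing A] {n : ℕ} {q : A} {x : ℕ → A} {β : ℕ → A}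

/-- The series `∑ β k (y T) ^ k`. -/
noncomputable def multSeries (β : ℕ → A) (y : A) : PowerSeries A :=
  PowerSeries.mk fun k => β k * y ^ k

/-- The product of the series `∑ β k (x i x j T) ^ k` over the pairs `1 ≤ i < j ≤ n`. -/
noncomputable def pairSeries (β : ℕ → A) (x : ℕ → A) (n : ℕ) : PowerSeries A :=
  ∏ i ∈ Finset.Icc 1 n, ∏ j ∈ Finset.Ioc i n, multSeries β (x i * x j)

theorem map_multSeries {B : Type*} [CommRing B] (f : A →+* B) (β : ℕ → A) (y : A) :
    PowerSeries.map f (multSeries β y) = multSeries (f ∘ β) (f y) := by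
  ext k
  simp [multSeries]

theorem map_pairSeries {B : Type*} [CommRing B] (f : A →+* B) (β x : ℕ → A) (n : ℕ) :
    PowerSeries.map f (pairSeries β x n) = pairSeries (f ∘ β) (f ∘ x) n := by
  simp [pairSeries, map_multSeries]

theorem multSeries_zero (hβ : β 0 = 1) : multSeries β 0 = 1 := by
  ext k
  rcases k with - | k <;> simp [multSeries, hβ, PowerSeries.coeff_one]

theorem multSeries_mul (hβ : β 0 = 1) (hβ' : ∀ k, (1 - q ^ (k + 1)) * β (k + 1) = β k) (y : A) :
    multSeries β (q * y) = (1 - PowerSeries.C y * PowerSeries.X) * multSeries β y := by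
  ext k
  rw [sub_mul, one_mul, mul_assoc, map_sub, PowerSeries.coeff_C_mul]
  rcases k with - | k
  · simp [multSeries, hβ]
  · rw [PowerSeries.coeff_succ_X_mul]
    simp only [multSeries, PowerSeries.coeff_mk]
    rw [← hβ' k]
    ring

theorem pairSeries_succ_of_eq_zero (hβ : β 0 = 1) (hx : x (n + 1) = 0) :
    pairSeries β x (n + 1) = pairSeries β x n := by
  rw [pairSeries, Finset.prod_Icc_succ_top (by omega), Finset.Ioc_self, Finset.prod_empty, mul_one]
  refine Finset.prod_congr rfl fun i hi => ?_
  rw [Finset.prod_Ioc_succ_top (Finset.mem_Icc.mp hi).2, hx, mul_zero, multSeries_zero hβ, mul_one]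

theorem pairSeries_update (hβ : β 0 = 1) (hβ' : ∀ k, (1 - q ^ (k + 1)) * β (k + 1) = β k) {i : ℕ}
    (hi : i ∈ Finset.Icc 1 n) :
    pairSeries β (Function.update x i (q * x i)) n =
      (∏ j ∈ (Finset.Icc 1 n).erase i, (1 - PowerSeries.C (x i * x j) * PowerSeries.X)) *
        pairSeries β x n := by
  set g : ℕ → PowerSeries A := fun j => 1 - PowerSeries.C (x i * x j) * PowerSeries.X with hg
  have hi' := Finset.mem_Icc.mp hi
  have key : ∀ a, ∀ b ∈ Finset.Ioc a n,
      multSeries β (Function.update x i (q * x i) a * Function.update x i (q * x i) b) =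
        ((if a = i then g b else 1) * (if b = i then g a else 1)) * multSeries β (x a * x b) := by
    intro a b hb
    have hab := (Finset.mem_Ioc.mp hb).1
    rcases eq_or_ne a i with rfl | ha
    · have hba : b ≠ a := hab.ne'
      simp only [Function.update_self, Function.update_of_ne hba, if_true, if_neg hba, mul_one]
      rw [mul_assoc, multSeries_mul hβ hβ']
    · rcases eq_or_ne b i with rfl | hbi
      · simp only [Function.update_self, Function.update_of_ne ha, if_true, if_neg ha, one_mul]
        rw [mul_left_comm, multSeries_mul hβ hβ', hg, mul_comm (x a)]
      · simp [ha, hbi]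
  have h1 : ∏ a ∈ Finset.Icc 1 n, ∏ b ∈ Finset.Ioc a n, (if a = i then g b else 1) =
      ∏ b ∈ Finset.Ioc i n, g b := by
    rw [Finset.prod_eq_single_of_mem i hi fun a _ ha => by simp [ha]]
    simp
  have h2 : ∏ a ∈ Finset.Icc 1 n, ∏ b ∈ Finset.Ioc a n, (if b = i then g a else 1) =
      ∏ a ∈ Finset.Ico 1 i, g a := by
    simp only [Finset.prod_ite_eq']
    rw [← Finset.prod_filter]
    refine Finset.prod_congr ?_ fun _ _ => rfl
    ext a
    simp only [Finset.mem_filter, Finset.mem_Icc, Finset.mem_Ioc, Finset.mem_Ico]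
    omega
  have h3 : (Finset.Icc 1 n).erase i = Finset.Ioc i n ∪ Finset.Ico 1 i := by
    ext a
    simp only [Finset.mem_erase, Finset.mem_Icc, Finset.mem_union, Finset.mem_Ioc, Finset.mem_Ico]
    omega
  have h4 : Disjoint (Finset.Ioc i n) (Finset.Ico 1 i) := by
    rw [Finset.disjoint_left]
    intro a ha hb
    have := Finset.mem_Ioc.mp ha
    have := Finset.mem_Ico.mp hb
    omega
  rw [h3, Finset.prod_union h4, ← h1, ← h2, pairSeries, pairSeries, ← Finset.prod_mul_distrib,
    ← Finset.prod_mul_distrib]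
  refine Finset.prod_congr rfl fun a _ => ?_
  rw [← Finset.prod_mul_distrib, ← Finset.prod_mul_distrib]
  exact Finset.prod_congr rfl (key a)

end PairSeries

section Lagrange

variable {K : Type*} [Field K]

theorem lagrangeSum_eval {ι : Type*} [DecidableEq ι] {s : Finset ι} {v : ι → K}
    (hv : Set.InjOn v s) {f : Polynomial K} (hf : f.degree < s.card) :
    lagrangeSum s v (fun i => f.eval (v i)) = f.eval 0 := by
  conv_rhs => rw [Lagrange.eq_interpolate hv hf, Lagrange.interpolate_apply,
    Polynomial.eval_finsetSum]
  refine Finset.sum_congr rfl fun i hi => ?_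
  rw [Polynomial.eval_mul, Polynomial.eval_C, mul_comm, Lagrange.basis, Polynomial.eval_prod]
  congr 1
  refine Finset.prod_congr rfl fun j hj => ?_
  have : v j - v i ≠ 0 := sub_ne_zero.mpr fun h =>
    Finset.ne_of_mem_erase hj (hv (Finset.mem_of_mem_erase hj) hi h)
  have : v i - v j ≠ 0 := by rwa [← neg_ne_zero, neg_sub]
  simp only [Lagrange.basisDivisor, Polynomial.eval_mul, Polynomial.eval_C, Polynomial.eval_sub,
    Polynomial.eval_X]
  field_simp
  ring

theorem lagrangeSum_one_sub_mul [CharZero K] {n : ℕ} {x : ℕ → K}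
    (hx : Set.InjOn x (Finset.Icc 1 n : Finset ℕ)) {t : K} (ht : t ≠ 0)
    (hxt : ∀ i ∈ Finset.Icc 1 n, 1 - x i ^ 2 * t ^ 2 ≠ 0) :
    (lagrangeSum (Finset.Icc 1 n) x fun i =>
        ∏ j ∈ (Finset.Icc 1 n).erase i, (1 - x i * x j * t ^ 2)) =
      1 - if Even n then (∏ a ∈ Finset.Icc 1 n, x a) * t ^ n else 0 := by
  set S := Finset.Icc 1 n with hS
  have h1 : ∀ i ∈ S, 1 - x i * t ≠ 0 := fun i hi h =>
    hxt i hi (by linear_combination (1 + x i * t) * h)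
  have h2 : ∀ i ∈ S, 1 + x i * t ≠ 0 := fun i hi h =>
    hxt i hi (by linear_combination (1 - x i * t) * h)
  set v : ℕ → K := fun i => if i = 0 then -t⁻¹ else if i = n + 1 then t⁻¹ else x i with hv
  have hv0 : v 0 = -t⁻¹ := by simp [hv]
  have hvn : v (n + 1) = t⁻¹ := by simp [hv]
  have hvS : ∀ i ∈ S, v i = x i := by
    intro i hi
    have := Finset.mem_Icc.mp hi
    simp [hv, show i ≠ 0 by omega, show i ≠ n + 1 by omega]
  have hn : n + 1 ∉ S := by simp [hS]
  have h0 : 0 ∉ insert (n + 1) S := by simp [hS]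
  have h0' : 0 ∉ S := by simp [hS]
  have hne : ∀ i ∈ S, x i ≠ t⁻¹ := fun i hi h => h1 i hi (by rw [h, inv_mul_cancel₀ ht, sub_self])
  have hne' : ∀ i ∈ S, x i ≠ -t⁻¹ := fun i hi h => h2 i hi (by
    rw [h, neg_mul, inv_mul_cancel₀ ht, add_neg_cancel])
  have hinj : Set.InjOn v (insert 0 (insert (n + 1) S) : Finset ℕ) := by
    rw [Finset.coe_insert, Set.injOn_insert (by simpa using h0), Finset.coe_insert,
      Set.injOn_insert (by simpa using hn)]
    refine ⟨⟨fun i hi j hj h => hx hi hj (by rwa [hvS i hi, hvS j hj] at h), ?_⟩, ?_⟩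
    · rintro ⟨i, hi, h⟩
      rw [hvS i hi, hvn] at h
      exact hne i hi h
    · rintro ⟨i, hi, h⟩
      rw [hv0] at h
      rcases hi with rfl | hi
      · rw [hvn] at h
        have : t⁻¹ = 0 := by linear_combination (1 / 2 : K) * h
        exact inv_ne_zero ht this
      · rw [hvS i hi] at h
        exact hne' i hi h
  set f : Polynomial K := ∏ j ∈ S, (1 - Polynomial.C (x j * t ^ 2) * Polynomial.X) with hf
  have hdeg : f.degree < (insert 0 (insert (n + 1) S)).card := by
    have : f.natDegree ≤ S.card := by
      refine (Polynomial.natDegree_prod_le _ _).trans ?_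
      refine (Finset.sum_le_card_nsmul _ _ 1 fun j _ => ?_).trans (by simp)
      compute_degree
    refine Polynomial.degree_le_natDegree.trans_lt ?_
    rw [Finset.card_insert_of_notMem h0, Finset.card_insert_of_notMem hn]
    exact_mod_cast (by omega : f.natDegree < S.card + 1 + 1)
  have heval : ∀ z, f.eval z = ∏ j ∈ S, (1 - x j * t ^ 2 * z) := fun z => by
    simp [hf, Polynomial.eval_prod]
  have key := lagrangeSum_eval hinj hdeg
  simp only [heval, mul_zero, sub_zero, Finset.prod_const_one] at key
  rw [lagrangeSum, Finset.sum_insert h0, Finset.sum_insert hn] at key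
  have hA0 : lagrangeCoeff (insert 0 (insert (n + 1) S)) v 0 * ∏ j ∈ S, (1 - x j * t ^ 2 * v 0) =
      (1 / 2) * ((∏ a ∈ S, x a) * t ^ n) := by
    rw [lagrangeCoeff_insert_self h0, Finset.prod_insert hn, hvn, hv0, mul_assoc,
      ← Finset.prod_mul_distrib]
    congr 1
    · field_simp
      norm_num
    · have : t ^ n = ∏ a ∈ S, t := by simp [hS]
      rw [this, ← Finset.prod_mul_distrib]
      refine Finset.prod_congr rfl fun j hj => ?_
      have := h2 j hj
      rw [hvS j hj]
      have h3 : x j - -t⁻¹ = (1 + x j * t) * t⁻¹ := by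
        field_simp
        ring
      have h4 : 1 - x j * t ^ 2 * -t⁻¹ = 1 + x j * t := by
        field_simp
        ring
      rw [h3, h4]
      field_simp
  have hA1 : lagrangeCoeff (insert 0 (insert (n + 1) S)) v (n + 1) *
      ∏ j ∈ S, (1 - x j * t ^ 2 * v (n + 1)) =
      (1 / 2) * ((∏ a ∈ S, x a) * (-t) ^ n) := by
    rw [lagrangeCoeff_insert h0 (by omega), lagrangeCoeff_insert_self hn, hvn, hv0, mul_assoc,
      ← Finset.prod_mul_distrib]
    congr 1
    · field_simp
      norm_num
    · have : (-t) ^ n = ∏ a ∈ S, -t := by simp [hS]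
      rw [this, ← Finset.prod_mul_distrib]
      refine Finset.prod_congr rfl fun j hj => ?_
      have := h1 j hj
      rw [hvS j hj]
      have h3 : x j - t⁻¹ = -(1 - x j * t) * t⁻¹ := by
        field_simp
        ring
      have h4 : 1 - x j * t ^ 2 * t⁻¹ = 1 - x j * t := by
        field_simp
      rw [h3, h4]
      field_simp
  have hAS : ∀ i ∈ S, lagrangeCoeff (insert 0 (insert (n + 1) S)) v i *
      ∏ j ∈ S, (1 - x j * t ^ 2 * v i) =
      lagrangeCoeff S x i * ∏ j ∈ S.erase i, (1 - x i * x j * t ^ 2) := by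
    intro i hi
    have hi' := Finset.mem_Icc.mp hi
    have hc : lagrangeCoeff S v i = lagrangeCoeff S x i :=
      Finset.prod_congr rfl fun j hj => by rw [hvS i hi, hvS j (Finset.mem_of_mem_erase hj)]
    rw [lagrangeCoeff_insert h0 (by omega), lagrangeCoeff_insert hn (by omega), hvn, hv0, hc,
      hvS i hi, ← Finset.mul_prod_erase S (fun j => 1 - x j * t ^ 2 * x i) hi]
    have h3 := h1 i hi
    have h4 := h2 i hi
    have h5 : -t⁻¹ - x i = -(1 + x i * t) * t⁻¹ := by
      field_simp
      ring
    have h6 : t⁻¹ - x i = (1 - x i * t) * t⁻¹ := by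
      field_simp
    have h7 : ∏ j ∈ S.erase i, (1 - x j * t ^ 2 * x i) = ∏ j ∈ S.erase i, (1 - x i * x j * t ^ 2) :=
      Finset.prod_congr rfl fun j _ => by ring
    have h8 : 1 - x i * t ^ 2 * x i = (1 - x i * t) * (1 + x i * t) := by ring
    rw [h5, h6, h7, h8]
    generalize 1 - x i * t = u at h3 ⊢
    generalize 1 + x i * t = w at h4 ⊢
    field_simp
  rw [hA0, hA1, Finset.sum_congr rfl hAS, ← lagrangeSum] at key
  rcases Nat.even_or_odd n with he | ho
  · rw [if_pos he]
    rw [he.neg_pow] at key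
    linear_combination key
  · rw [if_neg (Nat.not_even_iff_odd.mpr ho)]
    rw [ho.neg_pow] at key
    linear_combination key

theorem lagrangeSum_one_sub_mul_X [CharZero K] {n : ℕ} {x : ℕ → K}
    (hx : Set.InjOn x (Finset.Icc 1 n : Finset ℕ)) :
    (∑ i ∈ Finset.Icc 1 n, PowerSeries.C (lagrangeCoeff (Finset.Icc 1 n) x i) *
        ∏ j ∈ (Finset.Icc 1 n).erase i, (1 - PowerSeries.C (x i * x j) * PowerSeries.X)) =
      1 - if Even n then PowerSeries.C (∏ a ∈ Finset.Icc 1 n, x a) * PowerSeries.X ^ (n / 2)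
        else 0 := by
  set P : Polynomial K := (∑ i ∈ Finset.Icc 1 n,
    Polynomial.C (lagrangeCoeff (Finset.Icc 1 n) x i) *
      ∏ j ∈ (Finset.Icc 1 n).erase i, (1 - Polynomial.C (x i * x j) * Polynomial.X)) -
    (1 - if Even n then Polynomial.C (∏ a ∈ Finset.Icc 1 n, x a) * Polynomial.X ^ (n / 2)
      else 0) with hP
  set R : Polynomial K := Polynomial.X * ∏ i ∈ Finset.Icc 1 n,
    (1 - Polynomial.C (x i ^ 2) * Polynomial.X ^ 2) with hR
  have hR0 : R ≠ 0 := by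
    refine mul_ne_zero Polynomial.X_ne_zero (Finset.prod_ne_zero_iff.mpr fun i _ h => ?_)
    simpa using congrArg (Polynomial.eval 0) h
  have hcomp : R * P.comp (Polynomial.X ^ 2) = 0 := by
    refine Polynomial.funext fun t => ?_
    rw [Polynomial.eval_mul, Polynomial.eval_zero]
    by_cases hRt : R.eval t = 0
    · rw [hRt, zero_mul]
    rw [hR, Polynomial.eval_mul, Polynomial.eval_X, Polynomial.eval_prod] at hRt
    have key := lagrangeSum_one_sub_mul hx (left_ne_zero_of_mul hRt) (fun i hi => by
      simpa using Finset.prod_ne_zero_iff.mp (right_ne_zero_of_mul hRt) i hi)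
    suffices h : P.eval (t ^ 2) = 0 by simp [h]
    rw [hP, Polynomial.eval_sub, sub_eq_zero]
    convert key using 1
    · simp [Polynomial.eval_finsetSum, Polynomial.eval_prod, lagrangeSum]
    · rw [Polynomial.eval_sub, Polynomial.eval_one]
      split_ifs with hn
      · simp [← pow_mul, Nat.two_mul_div_two_of_even hn, Polynomial.eval_prod]
      · simp
  have hP0 : P = 0 := by
    rcases mul_eq_zero.mp hcomp with h | h
    · exact absurd h hR0
    · rcases Polynomial.comp_eq_zero_iff.mp h with h | ⟨-, h⟩
      · exact h
      · have := congrArg Polynomial.natDegree h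
        simp at this
  have hC : ∀ a : K, Polynomial.coeToPowerSeries.ringHom (Polynomial.C a) = PowerSeries.C a :=
    fun a => by simp
  have hX : Polynomial.coeToPowerSeries.ringHom (Polynomial.X : Polynomial K) = PowerSeries.X := by
    simp
  have := congrArg (Polynomial.coeToPowerSeries.ringHom (R := K)) (sub_eq_zero.mp hP0)
  simp only [map_sum, map_mul (Polynomial.coeToPowerSeries.ringHom (R := K)), map_prod, map_sub,
    map_one, hC, hX, apply_ite (Polynomial.coeToPowerSeries.ringHom (R := K)), map_zero,
    map_pow] at this
  simpa only [map_mul, map_prod] using this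

end Lagrange

/-! ### Uniqueness of the solution of the `q`-difference equation -/

section Uniqueness

open Filter Topology

theorem X_dvd_sub_aeval {σ R : Type*} [CommRing R] [DecidableEq σ] (s : σ)
    (p : MvPolynomial σ R) :
    MvPolynomial.X s ∣ p - MvPolynomial.aeval (Function.update MvPolynomial.X s 0) p := by
  induction p using MvPolynomial.induction_on with
  | C a => simp
  | add p p' hp hp' =>
    rw [map_add, add_sub_add_comm]
    exact dvd_add hp hp'
  | mul_X p i hp =>
    rw [map_mul, MvPolynomial.aeval_X]
    rcases eq_or_ne i s with rfl | hi
    · rw [Function.update_self, mul_zero, sub_zero]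
      exact dvd_mul_left _ _
    · rw [Function.update_of_ne hi, ← sub_mul]
      exact hp.mul_right _

theorem X_dvd_of_eval_eq_zero {K : Type*} [Field K] [CharZero K] {n : ℕ} (hn : 1 ≤ n)
    {G : MvPolynomial ℕ K}
    (hG : ∀ x : ℕ → K, x n = 0 → Set.InjOn x (Finset.Icc 1 n : Finset ℕ) →
      MvPolynomial.eval x G = 0) : MvPolynomial.X n ∣ G := by
  set φ : MvPolynomial ℕ K →ₐ[K] MvPolynomial ℕ K :=
    MvPolynomial.aeval (Function.update MvPolynomial.X n 0) with hφ
  have heval : ∀ (x : ℕ → K) (p : MvPolynomial ℕ K),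
      MvPolynomial.eval x (φ p) = MvPolynomial.eval (Function.update x n 0) p := by
    intro x p
    induction p using MvPolynomial.induction_on with
    | C a => simp [hφ]
    | add p p' hp hp' => simp [hp, hp']
    | mul_X p i hp =>
      rw [map_mul, map_mul, hp, map_mul, hφ, MvPolynomial.aeval_X, MvPolynomial.eval_X]
      rcases eq_or_ne i n with rfl | hi
      · simp
      · simp [Function.update_of_ne hi]
  set V : MvPolynomial ℕ K := ∏ i ∈ Finset.Icc 1 n, ∏ j ∈ (Finset.Icc 1 n).erase i,
    (MvPolynomial.X i - MvPolynomial.X j) with hV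
  have hVeval : ∀ x : ℕ → K, MvPolynomial.eval x V ≠ 0 ↔
      Set.InjOn x (Finset.Icc 1 n : Finset ℕ) := by
    intro x
    simp only [hV, map_prod, map_sub, MvPolynomial.eval_X, Finset.prod_ne_zero_iff, sub_ne_zero]
    constructor
    · intro h i hi j hj hij
      by_contra hne
      exact h i hi j (Finset.mem_erase.mpr ⟨fun h => hne h.symm, hj⟩) hij
    · intro h i hi j hj hij
      exact Finset.ne_of_mem_erase hj (h hi (Finset.mem_of_mem_erase hj) hij).symm
  have hφV : φ V ≠ 0 := by
    intro h
    have := congrArg (MvPolynomial.eval fun i : ℕ => (i : K)) h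
    rw [heval, map_zero] at this
    refine (hVeval _).mpr ?_ this
    intro i hi j hj hij
    have hi' := Finset.mem_Icc.mp (Finset.mem_coe.mp hi)
    have hj' := Finset.mem_Icc.mp (Finset.mem_coe.mp hj)
    rcases eq_or_ne i n with hin | hin <;> rcases eq_or_ne j n with hjn | hjn
    · rw [hin, hjn]
    · rw [hin, Function.update_self, Function.update_of_ne hjn] at hij
      have : j = 0 := by exact_mod_cast hij.symm
      omega
    · rw [hjn, Function.update_self, Function.update_of_ne hin] at hij
      have : i = 0 := by exact_mod_cast hij
      omega
    · rw [Function.update_of_ne hin, Function.update_of_ne hjn] at hij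
      exact_mod_cast hij
  have hmul : φ V * φ G = 0 := by
    refine MvPolynomial.funext fun x => ?_
    rw [map_mul, heval, heval, map_zero]
    by_cases h : MvPolynomial.eval (Function.update x n 0) V = 0
    · rw [h, zero_mul]
    · rw [hG _ (Function.update_self _ _ _) ((hVeval _).mp h), mul_zero]
  have hφG : φ G = 0 := (mul_eq_zero.mp hmul).resolve_left hφV
  have := X_dvd_sub_aeval n G
  rwa [← hφ, hφG, sub_zero] at this

theorem eq_zero_of_lagrangeSum_eq {n : ℕ} {q : ℂ} (hq : ∀ k, k ≠ 0 → q ^ k ≠ 1) (hn : 1 ≤ n)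
    {F : MvPolynomial ℕ ℂ}
    (hF : ∀ x : ℕ → ℂ, Set.InjOn x (Finset.Icc 1 n : Finset ℕ) →
      (lagrangeSum (Finset.Icc 1 n) x fun i =>
        MvPolynomial.eval (Function.update x i (q * x i)) F) = MvPolynomial.eval x F)
    (hF0 : ∀ x : ℕ → ℂ, x n = 0 → MvPolynomial.eval x F = 0) : F = 0 := by
  by_contra hne
  obtain ⟨k, G, hG, hFG⟩ := WfDvdMonoid.max_power_factor hne
    (MvPolynomial.X_prime (R := ℂ) (i := n)).irreducible
  have hk : k ≠ 0 := by
    rintro rfl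
    rw [pow_zero, one_mul] at hFG
    exact hG (hFG ▸ X_dvd_of_eval_eq_zero hn fun x hx _ => hF0 x hx)
  have hnS : n ∈ Finset.Icc 1 n := by simp [hn]
  refine hG (X_dvd_of_eval_eq_zero hn fun x hx hinj => ?_)
  set S := Finset.Icc 1 n with hS
  set y : ℂ → ℕ → ℂ := fun z => Function.update x n z with hy
  have hy0 : y 0 = x := by rw [hy, ← hx]; exact Function.update_eq_self n x
  have hyc : Continuous y := continuous_const.update n continuous_id
  have hyi : ∀ i, Continuous fun z => y z i := fun i => (continuous_apply i).comp hyc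
  have hxne : ∀ i ∈ S, ∀ j ∈ S, i ≠ j → x i - x j ≠ 0 := fun i hi j hj hij h =>
    hij (hinj hi hj (sub_eq_zero.mp h))
  have hev : ∀ᶠ z in 𝓝 (0 : ℂ), Set.InjOn (y z) (S : Finset ℕ) := by
    have : ∀ᶠ z in 𝓝 (0 : ℂ), ∀ i ∈ S, ∀ j ∈ S, i ≠ j → y z i - y z j ≠ 0 := by
      simp only [Filter.eventually_all_finset]
      intro i hi j hj
      by_cases hij : i = j
      · exact Eventually.of_forall fun z h => absurd hij h
      · refine (((hyi i).sub (hyi j)).continuousAt.eventually_ne ?_).mono fun z h _ => h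
        rw [Pi.sub_apply, hy0]
        exact hxne i hi j hj hij
    filter_upwards [this] with z hz i hi j hj hij
    by_contra hne
    exact hz i hi j hj hne (sub_eq_zero.mpr hij)
  have hcoeff : ∀ i ∈ S, ContinuousAt (fun z => lagrangeCoeff S (y z) i) 0 := by
    intro i hi
    refine tendsto_finsetProd _ fun j hj => ContinuousAt.div (hyi j).continuousAt
      ((hyi j).sub (hyi i)).continuousAt ?_
    rw [hy0]
    exact hxne j (Finset.mem_of_mem_erase hj) i hi (Finset.ne_of_mem_erase hj)
  set Φ : ℂ → ℂ := fun z => lagrangeSum S (y z) fun i =>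
    (if i = n then q ^ k else 1) *
      MvPolynomial.eval (Function.update (y z) i (q * y z i)) G with hΦ
  have hΦc : ContinuousAt Φ 0 := by
    refine tendsto_finsetSum _ fun i hi => (hcoeff i hi).mul
      (continuousAt_const.mul (Continuous.continuousAt ?_))
    exact (MvPolynomial.continuous_eval G).comp (hyc.update i (continuous_const.mul (hyi i)))
  have hGc : ContinuousAt (fun z => MvPolynomial.eval (y z) G) 0 :=
    ((MvPolynomial.continuous_eval G).comp hyc).continuousAt
  have heq : Φ =ᶠ[𝓝[≠] 0] fun z => MvPolynomial.eval (y z) G := by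
    filter_upwards [hev.filter_mono nhdsWithin_le_nhds, self_mem_nhdsWithin] with z hz hz0
    have hzk : z ^ k ≠ 0 := pow_ne_zero k hz0
    refine mul_left_cancel₀ hzk ?_
    have h := hF (y z) hz
    simp only [hFG, map_mul, map_pow, MvPolynomial.eval_X] at h
    rw [show y z n = z from Function.update_self _ _ _] at h
    rw [← h, hΦ]
    simp only [lagrangeSum, Finset.mul_sum]
    refine Finset.sum_congr rfl fun i _ => ?_
    rcases eq_or_ne i n with rfl | hin
    · rw [Function.update_self, if_pos rfl, show y z i = z from Function.update_self _ _ _]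
      ring
    · rw [if_neg hin, Function.update_of_ne hin.symm,
        show y z n = z from Function.update_self _ _ _]
      ring
  have hlim := tendsto_nhds_unique_of_eventuallyEq (hΦc.tendsto.mono_left nhdsWithin_le_nhds)
    (hGc.tendsto.mono_left nhdsWithin_le_nhds) heq
  have hΦ0 : Φ 0 = q ^ k * MvPolynomial.eval x G := by
    rw [hΦ]
    simp only [hy0, lagrangeSum]
    rw [Finset.sum_eq_single_of_mem n hnS]
    · have h1 : lagrangeCoeff S x n = 1 := by
        refine Finset.prod_eq_one fun j hj => ?_
        have := hxne j (Finset.mem_of_mem_erase hj) n hnS (Finset.ne_of_mem_erase hj)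
        rw [hx, sub_zero] at this ⊢
        exact div_self this
      have h2 : Function.update x n (q * x n) = x := by
        rw [hx, mul_zero, ← hx]
        exact Function.update_eq_self n x
      rw [h1, h2, if_pos rfl, one_mul]
    · intro i hi hin
      have : lagrangeCoeff S x i = 0 :=
        Finset.prod_eq_zero (Finset.mem_erase.mpr ⟨hin.symm, hnS⟩) (by rw [hx, zero_div])
      rw [this, zero_mul]
  rw [hΦ0, hy0] at hlim
  have : (q ^ k - 1) * MvPolynomial.eval x G = 0 := by linear_combination hlim
  exact (mul_eq_zero.mp this).resolve_left (sub_ne_zero.mpr (hq k hk))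

end Uniqueness

/-! ### The identity of formal series -/

section FormalIdentity

theorem lagrangeSum_coeff_pairSeries {K : Type*} [Field K] [CharZero K] {n : ℕ} {q : K}
    {x β : ℕ → K} (hβ : β 0 = 1) (hβ' : ∀ k, (1 - q ^ (k + 1)) * β (k + 1) = β k)
    (hx : Set.InjOn x (Finset.Icc 1 n : Finset ℕ)) (e : ℕ) :
    (lagrangeSum (Finset.Icc 1 n) x fun i =>
        PowerSeries.coeff e (pairSeries β (Function.update x i (q * x i)) n)) =
      PowerSeries.coeff e (pairSeries β x n) -
        if Even n then
          if n / 2 ≤ e then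
            (∏ a ∈ Finset.Icc 1 n, x a) * PowerSeries.coeff (e - n / 2) (pairSeries β x n)
          else 0
        else 0 := by
  have key := congrArg (fun f => PowerSeries.coeff e (f * pairSeries β x n))
    (lagrangeSum_one_sub_mul_X hx)
  have hL : (lagrangeSum (Finset.Icc 1 n) x fun i =>
        PowerSeries.coeff e (pairSeries β (Function.update x i (q * x i)) n)) =
      PowerSeries.coeff e ((∑ i ∈ Finset.Icc 1 n,
        PowerSeries.C (lagrangeCoeff (Finset.Icc 1 n) x i) *
          ∏ j ∈ (Finset.Icc 1 n).erase i, (1 - PowerSeries.C (x i * x j) * PowerSeries.X)) *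
        pairSeries β x n) := by
    rw [Finset.sum_mul, map_sum, lagrangeSum]
    refine Finset.sum_congr rfl fun i hi => ?_
    rw [pairSeries_update hβ hβ' hi, mul_assoc, PowerSeries.coeff_C_mul]
  rw [hL]
  refine key.trans ?_
  simp only [sub_mul, one_mul, map_sub]
  congr 1
  split_ifs with h1 h2
  · rw [mul_assoc, PowerSeries.coeff_C_mul, PowerSeries.coeff_X_pow_mul', if_pos h2]
  · rw [mul_assoc, PowerSeries.coeff_C_mul, PowerSeries.coeff_X_pow_mul', if_neg h2, mul_zero]
  · rw [zero_mul, map_zero]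

theorem evenSum_eq_coeff {q : ℂ} {β : ℕ → ℂ} (hq : ∀ k, k ≠ 0 → q ^ k ≠ 1) (hβ : β 0 = 1)
    (hβ' : ∀ k, (1 - q ^ (k + 1)) * β (k + 1) = β k) (n e : ℕ) (x : ℕ → ℂ) :
    evenSum β n q x e = PowerSeries.coeff e (pairSeries β x n) := by
  induction n generalizing e x with
  | zero => simp [evenSum_zero, pairSeries, PowerSeries.coeff_one]
  | succ n ih =>
    induction e using Nat.strong_induction_on generalizing x with
    | _ e ihe =>
    set F : MvPolynomial ℕ ℂ :=
      evenSum (MvPolynomial.C ∘ β) (n + 1) (MvPolynomial.C q) MvPolynomial.X e -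
        PowerSeries.coeff e (pairSeries (MvPolynomial.C ∘ β) MvPolynomial.X (n + 1)) with hF
    have heval : ∀ y, MvPolynomial.eval y F =
        evenSum β (n + 1) q y e - PowerSeries.coeff e (pairSeries β y (n + 1)) := by
      intro y
      have h1 : (MvPolynomial.eval y : MvPolynomial ℕ ℂ → ℂ) ∘ MvPolynomial.C ∘ β = β :=
        funext fun k => MvPolynomial.eval_C _
      have h2 : (MvPolynomial.eval y : MvPolynomial ℕ ℂ → ℂ) ∘ MvPolynomial.X = y :=
        funext fun k => MvPolynomial.eval_X _
      rw [hF, map_sub, map_evenSum, ← PowerSeries.coeff_map, map_pairSeries, h1, h2,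
        MvPolynomial.eval_C]
    suffices hF0 : F = 0 by
      have := heval x
      rw [hF0, map_zero] at this
      exact (sub_eq_zero.mp this.symm)
    refine eq_zero_of_lagrangeSum_eq hq (Nat.le_add_left 1 n) (fun y hy => ?_) fun y hy => ?_
    · have hsub : (lagrangeSum (Finset.Icc 1 (n + 1)) y fun i =>
            MvPolynomial.eval (Function.update y i (q * y i)) F) =
          (lagrangeSum (Finset.Icc 1 (n + 1)) y fun i =>
            evenSum β (n + 1) q (Function.update y i (q * y i)) e) -
          lagrangeSum (Finset.Icc 1 (n + 1)) y fun i =>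
            PowerSeries.coeff e (pairSeries β (Function.update y i (q * y i)) (n + 1)) := by
        simp only [heval, lagrangeSum, mul_sub, Finset.sum_sub_distrib]
      rw [hsub, lagrangeSum_coeff_pairSeries hβ hβ' hy, heval]
      rcases Nat.even_or_odd' (n + 1) with ⟨m, hm | hm⟩
      · have hm1 : 1 ≤ m := by omega
        rw [hm] at hy ihe ⊢
        rw [lagrangeSum_evenSum_even hm1 hβ hβ' hy, if_pos (even_two_mul m),
          Nat.mul_div_cancel_left m two_pos]
        split_ifs with hme
        · rw [ihe (e - m) (by omega)]
          ring
        · ring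
      · rw [lagrangeSum_evenSum_odd ⟨m, hm⟩ hy, if_neg (Nat.not_even_iff_odd.mpr ⟨m, hm⟩),
          sub_zero]
    · rw [heval, evenSum_succ_of_eq_zero _ hy, pairSeries_succ_of_eq_zero hβ hy, ih, sub_self]

end FormalIdentity

/-! ### The q-Whittaker polynomial as a transfer sum -/

section Tableaux

variable {n : ℕ}

/-- The columns of a tableau after each of them has been carried to the right end. -/
def carriedColumns (n : ℕ) : List (Finset ℕ) → List (Finset ℕ)
  | [] => []
  | x :: ys => ys.foldl (Rright n) x :: carriedColumns n ys

theorem rowE_append_singleton (n : ℕ) (x : Finset ℕ) (ys : List (Finset ℕ)) (c : Finset ℕ) :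
    rowE n x (ys ++ [c]) = rowE n x ys + Hloc n (ys.foldl (Rright n) x) c := by
  induction ys generalizing x with
  | nil => simp [rowE]
  | cons y ys ih => rw [List.cons_append, rowE, ih, rowE, List.foldl_cons, add_assoc]

theorem intrinsicE_append_singleton (n : ℕ) (V : List (Finset ℕ)) (c : Finset ℕ) :
    intrinsicE n (V ++ [c]) =
      intrinsicE n V + ((carriedColumns n V).map fun D => Hloc n D c).sum := by
  induction V with
  | nil => simp [intrinsicE, rowE, carriedColumns]
  | cons x V ih =>
    rw [List.cons_append, intrinsicE, ih, rowE_append_singleton, intrinsicE, carriedColumns,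
      List.map_cons, List.sum_cons]
    ring

theorem carriedColumns_append_singleton (n : ℕ) (V : List (Finset ℕ)) (c : Finset ℕ) :
    carriedColumns n (V ++ [c]) = (carriedColumns n V).map (fun D => Rright n D c) ++ [c] := by
  induction V with
  | nil => rfl
  | cons x V ih =>
    rw [List.cons_append, carriedColumns, ih, carriedColumns, List.map_cons, List.cons_append,
      List.foldl_append, List.foldl_cons, List.foldl_nil]

/-- The column tableaux with entries in `{1, …, n}` and column heights `hs`, read from right
to left. -/
def tableaux (n : ℕ) : List ℕ → Finset (List (Finset ℕ))
  | [] => {[]}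
  | h :: hs => (tableaux n hs ×ˢ (Finset.Icc 1 n).powersetCard h).image fun p => p.1 ++ [p.2]

theorem mem_tableaux {hs : List ℕ} {V : List (Finset ℕ)} :
    V ∈ tableaux n hs ↔ V.map Finset.card = hs.reverse ∧ ∀ D ∈ V, D ⊆ Finset.Icc 1 n := by
  induction hs generalizing V with
  | nil =>
    simp only [tableaux, Finset.mem_singleton, List.reverse_nil, List.map_eq_nil_iff]
    exact ⟨fun h => ⟨h, by simp [h]⟩, fun h => h.1⟩
  | cons h hs ih =>
    simp only [tableaux, Finset.mem_image, Finset.mem_product, Prod.exists, ih,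
      Finset.mem_powersetCard, List.reverse_cons]
    constructor
    · rintro ⟨W, c, ⟨⟨h1, h2⟩, h3, h4⟩, rfl⟩
      refine ⟨by rw [List.map_append, h1, List.map_singleton, h4], fun D hD => ?_⟩
      rcases List.mem_append.mp hD with hD | hD
      · exact h2 D hD
      · rwa [List.mem_singleton.mp hD]
    · rintro ⟨h1, h2⟩
      rcases List.eq_nil_or_concat' V with rfl | ⟨W, c, rfl⟩
      · simp at h1
      · rw [List.map_append, List.map_singleton] at h1
        obtain ⟨h3, h4⟩ := List.append_inj' h1 rfl
        exact ⟨W, c, ⟨⟨h3, fun D hD => h2 D (List.mem_append_left _ hD)⟩,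
          h2 c (by simp), by simpa using h4⟩, rfl⟩

theorem carriedColumns_mem_tableaux {hs : List ℕ} (hhs : hs.Pairwise (· ≤ ·))
    {V : List (Finset ℕ)} (hV : V ∈ tableaux n hs) : carriedColumns n V ∈ tableaux n hs := by
  induction hs generalizing V with
  | nil =>
    rw [tableaux, Finset.mem_singleton] at hV ⊢
    rw [hV, carriedColumns]
  | cons h hs ih =>
    rw [List.pairwise_cons] at hhs
    obtain ⟨⟨W, c⟩, hp, rfl⟩ := Finset.mem_image.mp hV
    obtain ⟨hW, hc⟩ := Finset.mem_product.mp hp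
    rw [Finset.mem_powersetCard] at hc
    obtain ⟨hcard, hsub⟩ := mem_tableaux.mp (ih hhs.2 hW)
    have hle : ∀ D ∈ carriedColumns n W, c.card ≤ D.card := by
      intro D hD
      rw [hc.2]
      refine hhs.1 _ ?_
      rw [← List.mem_reverse, ← hcard]
      exact List.mem_map_of_mem hD
    have hmap : (carriedColumns n W).map (fun D => Rright n D c) =
        (carriedColumns n W).map fun D => carry n D c :=
      List.map_congr_left fun D hD => Rright_eq_carry (hsub D hD) hc.1 (hle D hD)
    rw [carriedColumns_append_singleton, hmap, mem_tableaux]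
    constructor
    · rw [List.map_append, List.map_map, List.reverse_cons, ← hcard, List.map_singleton, hc.2]
      congr 1
      exact List.map_congr_left fun D hD => card_carry (hsub D hD) hc.1 (hle D hD)
    · intro D hD
      rcases List.mem_append.mp hD with hD | hD
      · obtain ⟨D', hD', rfl⟩ := List.mem_map.mp hD
        exact carry_subset (hsub D' hD') hc.1
      · rw [List.mem_singleton.mp hD]
        exact hc.1

theorem transferSum_eq_sum_tableaux {A : Type*} [CommRing A] {q : A} {x : ℕ → A} {hs : List ℕ}
    (hhs : hs.Pairwise (· ≤ ·)) (w : List (Finset ℕ) → A) :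
    transferSum n q x hs w = ∑ V ∈ tableaux n hs,
      q ^ intrinsicE n V * (V.map fun c => ∏ a ∈ c, x a).prod * w (carriedColumns n V) := by
  induction hs generalizing w with
  | nil => simp [tableaux, transferSum, intrinsicE, carriedColumns]
  | cons h hs ih =>
    have hhs' := List.pairwise_cons.mp hhs
    have hinj : Set.InjOn (fun p : List (Finset ℕ) × Finset ℕ => p.1 ++ [p.2])
        (tableaux n hs ×ˢ (Finset.Icc 1 n).powersetCard h : Finset _) := by
      rintro ⟨W, c⟩ - ⟨W', c'⟩ - hp
      obtain ⟨h1, h2⟩ := List.append_inj' hp rfl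
      exact Prod.ext h1 (by simpa using h2)
    rw [tableaux, Finset.sum_image hinj, Finset.sum_product_right, transferSum]
    refine Finset.sum_congr rfl fun c hc => ?_
    rw [ih hhs'.2, Finset.mul_sum]
    refine Finset.sum_congr rfl fun W hW => ?_
    rw [Finset.mem_powersetCard] at hc
    obtain ⟨hcard, hsub⟩ := mem_tableaux.mp (carriedColumns_mem_tableaux hhs'.2 hW)
    have hle : ∀ D ∈ carriedColumns n W, c.card ≤ D.card := by
      intro D hD
      rw [hc.2]
      refine hhs'.1 _ ?_
      rw [← List.mem_reverse, ← hcard]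
      exact List.mem_map_of_mem hD
    have hmap : (carriedColumns n W).map (fun D => Rright n D c) =
        (carriedColumns n W).map fun D => carry n D c :=
      List.map_congr_left fun D hD => Rright_eq_carry (hsub D hD) hc.1 (hle D hD)
    have hmap' : (carriedColumns n W).map (fun D => Hloc n D c) =
        (carriedColumns n W).map fun D => winding n D c :=
      List.map_congr_left fun D hD => Hloc_eq_winding (hsub D hD) hc.1 (hle D hD)
    rw [intrinsicE_append_singleton, carriedColumns_append_singleton, hmap, hmap', appendWeight,
      pow_add, List.map_append, List.prod_append, List.map_singleton, List.prod_singleton]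
    ring

theorem prod_pow_cnt {A : Type*} [CommRing A] (x : ℕ → A) {V : List (Finset ℕ)}
    (hV : ∀ D ∈ V, D ⊆ Finset.Icc 1 n) :
    ∏ a ∈ Finset.Icc 1 n, x a ^ cnt V a = (V.map fun c => ∏ a ∈ c, x a).prod := by
  induction V with
  | nil => simp [cnt]
  | cons c V ih =>
    rw [List.map_cons, List.prod_cons, ← ih fun D hD => hV D (List.mem_cons_of_mem c hD)]
    have : ∏ a ∈ c, x a = ∏ a ∈ Finset.Icc 1 n, x a ^ (if a ∈ c then 1 else 0) := by
      simp only [pow_ite, pow_one, pow_zero, Finset.prod_ite_mem]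
      rw [Finset.inter_eq_right.mpr (hV c (by simp))]
    rw [this, ← Finset.prod_mul_distrib]
    refine Finset.prod_congr rfl fun a _ => ?_
    rw [← pow_add]
    rfl

end Tableaux

section Shape

theorem lt_conj_iff (μ : YD) (r c : ℕ) : r < conj μ.val c ↔ c < μ.val r := by
  obtain ⟨N, hN⟩ := μ.prop.2
  have hex : ∃ r, μ.val r ≤ c := ⟨N, by omega⟩
  have hset : {r : ℕ | c + 1 ≤ μ.val r} = (Finset.range (Nat.find hex) : Set ℕ) := by
    ext r
    rw [Set.mem_ofPred_eq, Finset.coe_range, Set.mem_Iio]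
    constructor
    · intro h
      by_contra! hr
      have := μ.prop.1 _ _ hr
      have := Nat.find_spec hex
      omega
    · intro h
      have := Nat.find_min hex h
      omega
  have hconj : conj μ.val c = Nat.find hex := by
    rw [conj, hset, Nat.card_coe_set_eq, Set.ncard_coe_finset, Finset.card_range]
  rw [hconj]
  have := Set.ext_iff.mp hset r
  rw [Set.mem_ofPred_eq, Finset.coe_range, Set.mem_Iio] at this
  rw [← this]
  exact Nat.succ_le_iff

theorem conj_antitone (μ : YD) : Antitone (conj μ.val) := fun c d hcd =>
  le_of_forall_lt fun r hr => (lt_conj_iff μ r c).mpr (hcd.trans_lt ((lt_conj_iff μ r d).mp hr))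

/-- The column heights of a partition, read from right to left. -/
noncomputable def columnHeights (μ : YD) : List ℕ :=
  ((List.range (μ.val 0)).map (conj μ.val)).reverse

theorem pairwise_columnHeights (μ : YD) : (columnHeights μ).Pairwise (· ≤ ·) := by
  rw [columnHeights, List.pairwise_reverse, List.pairwise_map]
  exact List.pairwise_lt_range.imp fun h => conj_antitone μ h.le

theorem mem_tableaux_columnHeights (n : ℕ) (μ : YD) (L : List (Finset ℕ)) :
    (L.length = μ.val 0 ∧ ∀ j : Fin L.length, (L.get j).card = conj μ.val (j : ℕ) ∧
      ∀ a ∈ L.get j, 1 ≤ a ∧ a ≤ n) ↔ L ∈ tableaux n (columnHeights μ) := by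
  rw [mem_tableaux, columnHeights, List.reverse_reverse]
  constructor
  · rintro ⟨h1, h2⟩
    refine ⟨List.ext_getElem (by simp [h1]) fun i hi _ => ?_, fun D hD a ha => ?_⟩
    · rw [List.length_map] at hi
      simpa using (h2 ⟨i, hi⟩).1
    · obtain ⟨j, rfl⟩ := List.get_of_mem hD
      exact Finset.mem_Icc.mpr ((h2 j).2 a ha)
  · rintro ⟨h1, h2⟩
    refine ⟨by simpa using congrArg List.length h1, fun j => ⟨?_, fun a ha => ?_⟩⟩
    · have := List.getElem_of_eq h1 (i := j) (by simp)
      simpa using this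
    · exact Finset.mem_Icc.mp (h2 _ (List.get_mem L j) ha)

theorem qWhit_eq_colSum (n : ℕ) (x : ℕ → ℂ) (q : ℂ) (μ : YD) :
    qWhit n x q μ.val = colSum n q x (columnHeights μ) := by
  rw [colSum, transferSum_eq_sum_tableaux (pairwise_columnHeights μ),
    ← Finset.tsum_subtype (tableaux n (columnHeights μ)), qWhit,
    ← (Equiv.subtypeEquivRight (mem_tableaux_columnHeights n μ)).tsum_eq]
  refine tsum_congr fun V => ?_
  have hV := (mem_tableaux.mp ((mem_tableaux_columnHeights n μ V.val).mp V.prop)).2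
  rw [prod_pow_cnt x hV, mul_one]
  rfl

end Shape

/-! ### Partitions with even columns -/

section EvenColumns

theorem even_conj_iff (μ : YD) :
    (∀ c, Even (conj μ.val c)) ↔ ∀ a, μ.val (2 * a) = μ.val (2 * a + 1) := by
  constructor
  · refine fun h a => eq_of_forall_lt_iff fun c => ?_
    rw [← lt_conj_iff, ← lt_conj_iff]
    obtain ⟨k, hk⟩ := h c
    omega
  · intro h c
    by_contra hc
    obtain ⟨k, hk⟩ := Nat.not_even_iff_odd.mp hc
    have h1 := (lt_conj_iff μ (2 * k) c).mp (by omega)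
    rw [h, ← lt_conj_iff] at h1
    omega

/-- The halved column heights of a partition. -/
noncomputable def halfColumns (μ : YD) : Multiset ℕ :=
  ((List.range (μ.val 0)).map fun c => conj μ.val c / 2 : List ℕ)

theorem pos_of_mem_halfColumns {μ : YD} (hμ : ∀ c, Even (conj μ.val c)) {h : ℕ}
    (hh : h ∈ halfColumns μ) : 0 < h := by
  rw [halfColumns, Multiset.mem_coe, List.mem_map] at hh
  obtain ⟨c, hc, rfl⟩ := hh
  have := (lt_conj_iff μ 0 c).mpr (List.mem_range.mp hc)
  obtain ⟨k, hk⟩ := hμ c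
  omega

theorem evenHeights_halfColumns {μ : YD} (hμ : ∀ c, Even (conj μ.val c)) :
    evenHeights (halfColumns μ) = columnHeights μ := by
  refine List.Perm.eq_of_pairwise (le := (· ≤ ·)) (fun a b _ _ h h' => le_antisymm h h')
    (pairwise_evenHeights _) (pairwise_columnHeights μ) ?_
  rw [← Multiset.coe_eq_coe, evenHeights, columnHeights, Multiset.coe_reverse, ← Multiset.map_coe,
    Multiset.sort_eq, halfColumns, Multiset.map_coe, List.map_map]
  congr 1
  exact List.map_congr_left fun c _ => Nat.two_mul_div_two_of_even (hμ c)

theorem countP_halfColumns {μ : YD} (hμ : ∀ c, Even (conj μ.val c)) (r : ℕ) :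
    (halfColumns μ).countP (fun h => r < 2 * h) = μ.val r := by
  have h0 := μ.prop.1 0 r (Nat.zero_le r)
  rw [halfColumns, Multiset.coe_countP, List.countP_map, List.countP_eq_length_filter]
  have : (List.range (μ.val 0)).filter ((fun h => decide (r < 2 * h)) ∘ fun c => conj μ.val c / 2) =
      (List.range (μ.val 0)).filter fun c => decide (c < μ.val r) := by
    refine List.filter_congr fun c _ => ?_
    rw [Function.comp_apply, Nat.two_mul_div_two_of_even (hμ c), decide_eq_decide]
    exact lt_conj_iff μ r c
  rw [this, ← List.countP_eq_length_filter, ← Multiset.coe_countP, ← Multiset.range,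
    Multiset.countP_eq_card_filter]
  have h2 : (Multiset.range (μ.val 0)).filter (fun c => c < μ.val r) = Multiset.range (μ.val r) := by
    refine (Multiset.Nodup.ext ((Multiset.nodup_range _).filter _) (Multiset.nodup_range _)).mpr
      fun c => ?_
    simp only [Multiset.mem_filter, Multiset.mem_range]
    omega
  rw [h2, Multiset.card_range]

theorem count_add_countP (s : Multiset ℕ) (h : ℕ) :
    s.count (h + 1) + s.countP (fun g => 2 * h + 2 < 2 * g) =
      s.countP fun g => 2 * h + 1 < 2 * g := by
  induction s using Multiset.induction_on with
  | empty => simp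
  | cons a s ih =>
    simp only [Multiset.count_cons, Multiset.countP_cons]
    split_ifs <;> omega

theorem eq_of_countP_eq {s t : Multiset ℕ} (hs : ∀ h ∈ s, 0 < h) (ht : ∀ h ∈ t, 0 < h)
    (h : ∀ r, s.countP (fun h => r < 2 * h) = t.countP fun h => r < 2 * h) : s = t := by
  ext g
  rcases g with - | g
  · rw [Multiset.count_eq_zero_of_notMem fun h0 => (hs 0 h0).ne rfl,
      Multiset.count_eq_zero_of_notMem fun h0 => (ht 0 h0).ne rfl]
  · have h1 := count_add_countP s g
    have h2 := count_add_countP t g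
    have h3 := h (2 * g + 2)
    have h4 := h (2 * g + 1)
    omega

/-- The partition whose columns have the heights `2 h`, for `h` in `s`. -/
def doubledConj (s : Multiset ℕ) : YD :=
  ⟨fun r => s.countP fun h => r < 2 * h, fun i j hij => by
    simp only [Multiset.countP_eq_card_filter]
    exact Multiset.card_le_card (Multiset.monotone_filter_right s fun h hj => hij.trans_lt hj),
    2 * s.sum, Multiset.countP_eq_zero.mpr fun h hh => by
      have := Multiset.le_sum_of_mem hh
      omega⟩

theorem even_conj_doubledConj (s : Multiset ℕ) (c : ℕ) : Even (conj (doubledConj s).val c) := by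
  refine (even_conj_iff (doubledConj s)).mpr (fun a => ?_) c
  refine Multiset.countP_congr rfl fun h _ => ?_
  rw [eq_iff_iff]
  omega

theorem sigma_partition_ext {π ρ : Σ e, Nat.Partition e} (h : π.2.parts = ρ.2.parts) : π = ρ := by
  obtain ⟨e, s, hs, rfl⟩ := π
  obtain ⟨f, t, ht, rfl⟩ := ρ
  obtain rfl : s = t := h
  rfl

/-- Partitions with even columns correspond to arbitrary partitions by halving the columns. -/
noncomputable def evenColumnsEquiv :
    {μ : YD // ∀ c, Even (conj μ.val c)} ≃ Σ e, Nat.Partition e where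
  toFun μ := ⟨(halfColumns μ.val).sum, halfColumns μ.val, pos_of_mem_halfColumns μ.prop, rfl⟩
  invFun π := ⟨doubledConj π.2.parts, even_conj_doubledConj π.2.parts⟩
  left_inv μ := Subtype.ext (Subtype.ext (funext fun r => countP_halfColumns μ.prop r))
  right_inv π := by
    obtain ⟨e, s, hs, rfl⟩ := π
    have : halfColumns (doubledConj s) = s :=
      eq_of_countP_eq (fun h => pos_of_mem_halfColumns (even_conj_doubledConj s)) (fun h => hs)
        fun r => countP_halfColumns (even_conj_doubledConj s) r
    exact sigma_partition_ext this

theorem bmu_eq_multCoeff (q : ℂ) {μ : YD} (hμ : ∀ c, Even (conj μ.val c)) :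
    bmu q μ.val = multCoeff (fun k => (qPoch q k)⁻¹) (halfColumns μ) := by
  have hdiff : ∀ h, μ.val (2 * h + 1) - μ.val (2 * h + 1 + 1) = (halfColumns μ).count (h + 1) := by
    intro h
    have := count_add_countP (halfColumns μ) h
    rw [countP_halfColumns hμ, countP_halfColumns hμ] at this
    rw [← this, Nat.add_sub_cancel]
  have hinj : Set.InjOn (fun h => 2 * h - 1) ((halfColumns μ).toFinset : Set ℕ) := by
    intro a ha b hb hab
    have := pos_of_mem_halfColumns hμ (Multiset.mem_toFinset.mp ha)
    have := pos_of_mem_halfColumns hμ (Multiset.mem_toFinset.mp hb)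
    simp only at hab
    omega
  rw [bmu, finprod_eq_prod_of_mulSupport_subset
      (s := (halfColumns μ).toFinset.image fun h => 2 * h - 1),
    Finset.prod_image hinj]
  · refine Finset.prod_congr rfl fun h hh => ?_
    have := pos_of_mem_halfColumns hμ (Multiset.mem_toFinset.mp hh)
    obtain ⟨g, rfl⟩ : ∃ g, h = g + 1 := ⟨h - 1, by omega⟩
    rw [← hdiff g]
    rfl
  · intro i hi
    rw [Function.mem_mulSupport] at hi
    rcases Nat.even_or_odd' i with ⟨a, rfl | rfl⟩
    · refine absurd ?_ hi
      rw [(even_conj_iff μ).mp hμ a, Nat.sub_self]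
      simp [qPoch]
    · rw [hdiff] at hi
      refine Finset.mem_coe.mpr (Finset.mem_image.mpr ⟨a + 1, ?_, by omega⟩)
      by_contra h
      rw [Multiset.mem_toFinset] at h
      rw [Multiset.count_eq_zero_of_notMem h] at hi
      exact hi (by simp [qPoch])

theorem tsum_even_columns (n : ℕ) (q : ℂ) (x : ℕ → ℂ) :
    ∑' μ : {μ : YD // ∀ c, Even (conj μ.val c)}, bmu q μ.val.val * qWhit n x q μ.val.val =
      ∑' π : Σ e, Nat.Partition e, multCoeff (fun k => (qPoch q k)⁻¹) π.2.parts *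
        colSum n q x (evenHeights π.2.parts) := by
  rw [← evenColumnsEquiv.tsum_eq]
  refine tsum_congr fun μ => ?_
  rw [bmu_eq_multCoeff q μ.prop, qWhit_eq_colSum, ← evenHeights_halfColumns μ.prop]
  rfl

end EvenColumns

/-! ### Convergence and the `q`-binomial theorem -/

section Analysis

open Filter Topology

variable {q : ℂ}

theorem pow_ne_one_of_norm_lt_one (hq : ‖q‖ < 1) {k : ℕ} (hk : k ≠ 0) : q ^ k ≠ 1 := by
  intro h
  have := pow_lt_one₀ (norm_nonneg q) hq hk
  rw [← norm_pow, h, norm_one] at this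
  exact lt_irrefl _ this

theorem qPoch_ne_zero (hq : ‖q‖ < 1) (k : ℕ) : qPoch q k ≠ 0 :=
  Finset.prod_ne_zero_iff.mpr fun _ _ =>
    sub_ne_zero.mpr (pow_ne_one_of_norm_lt_one hq (Nat.succ_ne_zero _)).symm

theorem inv_qPoch_zero : (qPoch q 0)⁻¹ = 1 := by simp [qPoch]

theorem mul_inv_qPoch_succ (hq : ‖q‖ < 1) (k : ℕ) :
    (1 - q ^ (k + 1)) * (qPoch q (k + 1))⁻¹ = (qPoch q k)⁻¹ := by
  have h1 := qPoch_ne_zero hq k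
  have h2 := qPoch_ne_zero hq (k + 1)
  have h3 : qPoch q (k + 1) = qPoch q k * (1 - q ^ (k + 1)) := Finset.prod_range_succ _ _
  rw [h3] at h2 ⊢
  have h4 := right_ne_zero_of_mul h2
  field_simp

theorem summable_inv_qPoch_mul_pow (hq : ‖q‖ < 1) {y : ℂ} (hy : ‖y‖ < 1) :
    Summable fun k => ‖(qPoch q k)⁻¹ * y ^ k‖ := by
  rcases eq_or_ne y 0 with rfl | hy0
  · refine summable_of_ne_finset_zero (s := {0}) fun k hk => ?_
    simp [Finset.notMem_singleton.mp hk]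
  have hne : ∀ k, (qPoch q k)⁻¹ * y ^ k ≠ 0 := fun k =>
    mul_ne_zero (inv_ne_zero (qPoch_ne_zero hq k)) (pow_ne_zero k hy0)
  refine (summable_of_ratio_test_tendsto_lt_one (l := ‖y‖) hy
    (Eventually.of_forall fun k => norm_ne_zero_iff.mpr (hne k)) ?_)
  have h1 : Tendsto (fun k : ℕ => ‖y‖ / ‖1 - q ^ (k + 1)‖) atTop (𝓝 (‖y‖ / ‖(1 : ℂ) - 0‖)) := by
    refine Tendsto.div tendsto_const_nhds (Tendsto.norm ?_) (by simp)
    exact ((tendsto_pow_atTop_nhds_zero_of_norm_lt_one hq).comp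
      (tendsto_add_atTop_nat 1)).const_sub 1
  rw [sub_zero, norm_one, div_one] at h1
  refine h1.congr fun k => ?_
  have h2 : (1 : ℂ) - q ^ (k + 1) ≠ 0 :=
    sub_ne_zero.mpr (pow_ne_one_of_norm_lt_one hq (Nat.succ_ne_zero _)).symm
  rw [norm_norm, norm_norm, ← norm_div, ← norm_div, ← mul_inv_qPoch_succ hq k]
  congr 1
  have h3 := qPoch_ne_zero hq (k + 1)
  field_simp
  ring

theorem norm_pow_mul_lt_one (hq : ‖q‖ < 1) {y : ℂ} (hy : ‖y‖ < 1) (k : ℕ) : ‖q ^ k * y‖ < 1 := by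
  rw [norm_mul, norm_pow]
  exact (mul_le_of_le_one_left (norm_nonneg y) (pow_le_one₀ (norm_nonneg q) hq.le)).trans_lt hy

theorem tsum_inv_qPoch_mul_pow_rec (hq : ‖q‖ < 1) {y : ℂ} (hy : ‖y‖ < 1) :
    (1 - y) * ∑' k, (qPoch q k)⁻¹ * y ^ k = ∑' k, (qPoch q k)⁻¹ * (q * y) ^ k := by
  have hs := (summable_inv_qPoch_mul_pow hq hy).of_norm
  have hs' := (summable_inv_qPoch_mul_pow hq
    (by simpa using norm_pow_mul_lt_one hq hy 1 : ‖q * y‖ < 1)).of_norm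
  have h0 := hs.tsum_eq_zero_add
  rw [sub_mul, one_mul, ← tsum_mul_left, hs'.tsum_eq_zero_add]
  nth_rewrite 1 [h0]
  rw [add_sub_assoc, ← Summable.tsum_sub ((summable_nat_add_iff 1).mpr hs) (hs.mul_left y)]
  simp only [pow_zero, mul_one]
  congr 1
  refine tsum_congr fun k => ?_
  rw [← mul_inv_qPoch_succ hq k]
  ring

theorem tsum_inv_qPoch_mul_prod (hq : ‖q‖ < 1) {y : ℂ} (hy : ‖y‖ < 1) (N : ℕ) :
    (∑' k, (qPoch q k)⁻¹ * y ^ k) * ∏ k ∈ Finset.range N, (1 - q ^ k * y) =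
      ∑' k, (qPoch q k)⁻¹ * (q ^ N * y) ^ k := by
  induction N with
  | zero => simp
  | succ N ih =>
    rw [Finset.prod_range_succ, ← mul_assoc, ih, mul_comm,
      tsum_inv_qPoch_mul_pow_rec hq (norm_pow_mul_lt_one hq hy N)]
    simp only [pow_succ' q N, mul_assoc]

theorem tsum_inv_qPoch_mul_pow (hq : ‖q‖ < 1) {y : ℂ} (hy : ‖y‖ < 1) :
    ∑' k, (qPoch q k)⁻¹ * y ^ k = (qPochInf y q)⁻¹ := by
  have hmul : Multipliable fun k : ℕ => 1 - q ^ k * y := by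
    simp only [sub_eq_add_neg]
    refine Complex.multipliable_one_add_of_summable (Summable.of_norm ?_)
    simp only [norm_neg, norm_mul, norm_pow]
    exact (summable_geometric_of_lt_one (norm_nonneg q) hq).mul_right _
  have h1 := (hmul.tendsto_prod_tprod_nat).const_mul (∑' k, (qPoch q k)⁻¹ * y ^ k)
  simp only [tsum_inv_qPoch_mul_prod hq hy] at h1
  have h2 : Tendsto (fun N : ℕ => ∑' k, (qPoch q k)⁻¹ * (q ^ N * y) ^ k) atTop
      (𝓝 (∑' k, (qPoch q k)⁻¹ * (0 * y) ^ k)) := by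
    refine tendsto_tsum_of_dominated_convergence (summable_inv_qPoch_mul_pow hq hy) (fun k => ?_)
      (Eventually.of_forall fun N k => ?_)
    · exact (((tendsto_pow_atTop_nhds_zero_of_norm_lt_one hq).mul_const y).pow k).const_mul _
    · rw [norm_mul, norm_mul, norm_pow, norm_pow]
      gcongr
      rw [norm_mul, norm_pow]
      exact mul_le_of_le_one_left (norm_nonneg y) (pow_le_one₀ (norm_nonneg q) hq.le)
  have h3 : ∑' k, (qPoch q k)⁻¹ * (0 * y) ^ k = 1 := by
    rw [tsum_eq_single 0 fun k hk => by simp [hk]]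
    simp [inv_qPoch_zero]
  rw [h3] at h2
  exact eq_inv_of_mul_eq_one_left (tendsto_nhds_unique h1 h2)

/-- The coefficients of the power series `f` are absolutely summable with sum `s`. -/
def HasAbsSum (f : PowerSeries ℂ) (s : ℂ) : Prop :=
  (Summable fun e => ‖PowerSeries.coeff e f‖) ∧ ∑' e, PowerSeries.coeff e f = s

theorem HasAbsSum.one : HasAbsSum 1 1 := by
  constructor
  · refine summable_of_ne_finset_zero (s := {0}) fun k hk => ?_
    simp [PowerSeries.coeff_one, Finset.notMem_singleton.mp hk]
  · simp [PowerSeries.coeff_one]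

theorem HasAbsSum.mul {f g : PowerSeries ℂ} {s t : ℂ} (hf : HasAbsSum f s) (hg : HasAbsSum g t) :
    HasAbsSum (f * g) (s * t) := by
  constructor
  · simpa only [PowerSeries.coeff_mul] using
      summable_norm_sum_mul_antidiagonal_of_summable_norm hf.1 hg.1
  · simp only [PowerSeries.coeff_mul]
    rw [← tsum_mul_tsum_eq_tsum_sum_antidiagonal_of_summable_norm hf.1 hg.1, hf.2, hg.2]

theorem HasAbsSum.prod {ι : Type*} {S : Finset ι} {f : ι → PowerSeries ℂ} {s : ι → ℂ}
    (h : ∀ i ∈ S, HasAbsSum (f i) (s i)) : HasAbsSum (∏ i ∈ S, f i) (∏ i ∈ S, s i) := by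
  classical
  induction S using Finset.induction_on with
  | empty => simpa using HasAbsSum.one
  | insert a S ha ih =>
    rw [Finset.prod_insert ha, Finset.prod_insert ha]
    exact (h a (Finset.mem_insert_self a S)).mul
      (ih fun i hi => h i (Finset.mem_insert_of_mem hi))

theorem hasAbsSum_pairSeries (hq : ‖q‖ < 1) {n : ℕ} {x : ℕ → ℂ}
    (hx : ∀ i ∈ Finset.Icc 1 n, ∀ j ∈ Finset.Icc 1 n, ‖x i * x j‖ < 1) :
    HasAbsSum (pairSeries (fun k => (qPoch q k)⁻¹) x n)
      (∏ i ∈ Finset.Icc 1 n, ∏ j ∈ Finset.Ioc i n, (qPochInf (x i * x j) q)⁻¹) := by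
  refine HasAbsSum.prod fun i hi => HasAbsSum.prod fun j hj => ?_
  have hij : ‖x i * x j‖ < 1 := hx i hi j <| by
    have := Finset.mem_Icc.mp hi
    have := Finset.mem_Ioc.mp hj
    exact Finset.mem_Icc.mpr (by omega)
  constructor
  · simpa only [multSeries, PowerSeries.coeff_mk] using summable_inv_qPoch_mul_pow hq hij
  · simpa only [multSeries, PowerSeries.coeff_mk] using tsum_inv_qPoch_mul_pow hq hij

theorem norm_transferSum_le (n : ℕ) (q : ℂ) (x : ℕ → ℂ) (hs : List ℕ) {w : List (Finset ℕ) → ℂ}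
    {w' : List (Finset ℕ) → ℝ} (hw : ∀ Ds, ‖w Ds‖ ≤ w' Ds) :
    ‖transferSum n q x hs w‖ ≤ transferSum n ‖q‖ (fun a => ‖x a‖) hs w' := by
  induction hs generalizing w w' with
  | nil => exact hw []
  | cons h hs ih =>
    refine (norm_sum_le _ _).trans (Finset.sum_le_sum fun c _ => ?_)
    rw [norm_mul, norm_prod]
    refine mul_le_mul_of_nonneg_left (ih fun Ds => ?_) (Finset.prod_nonneg fun a _ => norm_nonneg _)
    rw [appendWeight, appendWeight, norm_mul, norm_pow]
    exact mul_le_mul_of_nonneg_left (hw _) (pow_nonneg (norm_nonneg q) _)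

theorem norm_inv_qPoch_le (hq : ‖q‖ < 1) (k : ℕ) :
    ‖(qPoch q k)⁻¹‖ ≤ (∏ j ∈ Finset.range k, (1 - ‖q‖ ^ (j + 1)))⁻¹ := by
  have hpos : ∀ j : ℕ, 0 < 1 - ‖q‖ ^ (j + 1) := fun j =>
    sub_pos.mpr (pow_lt_one₀ (norm_nonneg q) hq (Nat.succ_ne_zero j))
  rw [norm_inv, qPoch, norm_prod]
  refine inv_anti₀ (Finset.prod_pos fun j _ => hpos j)
    (Finset.prod_le_prod (fun j _ => (hpos j).le) fun j _ => ?_)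
  simpa using norm_sub_norm_le 1 (q ^ (j + 1))

theorem norm_multCoeff_le {β : ℕ → ℂ} {β' : ℕ → ℝ} (h : ∀ k, ‖β k‖ ≤ β' k) (s : Multiset ℕ) :
    ‖multCoeff β s‖ ≤ multCoeff β' s := by
  rw [multCoeff, norm_prod]
  exact Finset.prod_le_prod (fun _ _ => norm_nonneg _) fun _ _ => h _

theorem evenSum_eq_coeff_pairSeries (hq : ‖q‖ < 1) (n : ℕ) (x : ℕ → ℂ) (e : ℕ) :
    evenSum (fun k => (qPoch q k)⁻¹) n q x e =
      PowerSeries.coeff e (pairSeries (fun k => (qPoch q k)⁻¹) x n) :=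
  evenSum_eq_coeff (fun _ hk => pow_ne_one_of_norm_lt_one hq hk) inv_qPoch_zero
    (mul_inv_qPoch_succ hq) n e x

theorem summable_multCoeff_mul_colSum (hq : ‖q‖ < 1) {n : ℕ} {x : ℕ → ℂ}
    (hx : ∀ i ∈ Finset.Icc 1 n, ∀ j ∈ Finset.Icc 1 n, ‖x i * x j‖ < 1) :
    Summable fun π : Σ e, Nat.Partition e =>
      multCoeff (fun k => (qPoch q k)⁻¹) π.2.parts * colSum n q x (evenHeights π.2.parts) := by
  set β' : ℕ → ℝ := fun k => (∏ j ∈ Finset.range k, (1 - ‖q‖ ^ (j + 1)))⁻¹ with hβ'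
  set g : (Σ e, Nat.Partition e) → ℝ := fun π =>
    multCoeff β' π.2.parts * colSum n ‖q‖ (fun a => ‖x a‖) (evenHeights π.2.parts)
  have hle : ∀ π : Σ e, Nat.Partition e,
      ‖multCoeff (fun k => (qPoch q k)⁻¹) π.2.parts * colSum n q x (evenHeights π.2.parts)‖ ≤
        g π := by
    intro π
    have h1 := norm_multCoeff_le (norm_inv_qPoch_le hq) π.2.parts
    rw [norm_mul]
    exact mul_le_mul h1 (norm_transferSum_le n q x _ fun _ => norm_one.le) (norm_nonneg _)
      ((norm_nonneg _).trans h1)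
  refine Summable.of_norm_bounded ?_ hle
  have hg : ∀ π, 0 ≤ g π := fun π => (norm_nonneg _).trans (hle π)
  refine (summable_sigma_of_nonneg hg).mpr ⟨fun e => Summable.of_finite, ?_⟩
  have hq' : ‖(‖q‖ : ℂ)‖ < 1 := by simpa using hq
  have hsum := (hasAbsSum_pairSeries (q := ‖q‖) hq' (x := fun a => (‖x a‖ : ℂ))
    fun i hi j hj => by simpa using hx i hi j hj).1
  refine hsum.congr fun e => ?_
  have hβ : (fun k => (qPoch (‖q‖ : ℂ) k)⁻¹) = Complex.ofRealHom ∘ β' := by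
    funext k
    simp [hβ', qPoch]
  have hmap := map_evenSum (n := n) (q := ‖q‖) (x := fun a => ‖x a‖) Complex.ofRealHom β' e
  rw [← evenSum_eq_coeff_pairSeries hq', tsum_fintype]
  change _ = evenSum β' n ‖q‖ (fun a => ‖x a‖) e
  rw [hβ]
  change ‖evenSum _ n (Complex.ofRealHom ‖q‖) (Complex.ofRealHom ∘ fun a => ‖x a‖) e‖ = _
  rw [← hmap, Complex.ofRealHom_eq_coe, Complex.norm_real, Real.norm_eq_abs]
  exact abs_of_nonneg (Finset.sum_nonneg fun π _ => hg ⟨e, π⟩)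

theorem tsum_even_columns_eq_prod (hq : ‖q‖ < 1) {n : ℕ} {x : ℕ → ℂ}
    (hx : ∀ i ∈ Finset.Icc 1 n, ∀ j ∈ Finset.Icc 1 n, ‖x i * x j‖ < 1) :
    ∑' μ : {μ : YD // ∀ c, Even (conj μ.val c)}, bmu q μ.val.val * qWhit n x q μ.val.val =
      ∏ i ∈ Finset.Icc 1 n, ∏ j ∈ Finset.Ioc i n, (qPochInf (x i * x j) q)⁻¹ := by
  rw [tsum_even_columns, (summable_multCoeff_mul_colSum hq hx).tsum_sigma,
    ← (hasAbsSum_pairSeries hq hx).2]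
  refine tsum_congr fun e => ?_
  rw [tsum_fintype, ← evenSum_eq_coeff_pairSeries hq]
  rfl

end Analysis

end QWhittaker

/-- Littlewood identity for q-Whittaker polynomials at even modulus: the sum is over
partitions all of whose columns have even length. -/
theorem qWhittaker_Littlewood_even (n : ℕ) (q : ℂ) (hq : ‖q‖ < 1) (x : ℕ → ℂ)
    (hx : ∀ i ∈ Finset.Icc 1 n, ∀ j ∈ Finset.Icc 1 n, ‖x i * x j‖ < 1) :
    ∑' μ : {μ : YD // ∀ c, Even (conj μ.val c)},
        bmu (q ^ 2) μ.val.val * qWhit n x (q ^ 2) μ.val.val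
      = ∏ i ∈ Finset.Icc 1 n, ∏ j ∈ Finset.Ioc i n, (qPochInf (x i * x j) (q ^ 2))⁻¹ := by
  exact QWhittaker.tsum_even_columns_eq_prod
    (by simpa using pow_lt_one₀ (norm_nonneg q) hq two_ne_zero) hx
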